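/- arXiv:math/0306217 — 15 statements merged into one kernel-verified Lean document; each statement's English description precedes it below -/
import Mathlib

section
/- For every functional ξ ∈ (ℝ^d)^*, ξ lies in the image Υ(Z) of the zero level set Z under Υ if and only if ξ = π^*(μ) for some μ ∈ Δ; in other words, Υ(Z) = π^*(Δ), so the image of the moment mapping on the reduced space is exactly the polytope Δ. -/
noncomputable section

open scoped BigOperators

/-- The subgroup `ℤ^d ⊆ ℝ^d`. -/
def intLattice (d : ℕ) : AddSubgroup (Fin d → ℝ) where
  carrier := {x | ∀ j, ∃ m : ℤ, x j = (m : ℝ)}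
  zero_mem' := fun j => ⟨0, by simp⟩
  add_mem' := by
    rintro a b ha hb j
    obtain ⟨m, hm⟩ := ha j
    obtain ⟨k, hk⟩ := hb j
    exact ⟨m + k, by simp [hm, hk]⟩
  neg_mem' := by
    rintro a ha j
    obtain ⟨m, hm⟩ := ha j
    exact ⟨-m, by simp [hm]⟩

/-- The torus `T^d = ℝ^d / ℤ^d`. -/
abbrev Torus (d : ℕ) := (Fin d → ℝ) ⧸ intLattice d

/-- The quotient map `ℝ^d → T^d`. -/
def torusMk (d : ℕ) : (Fin d → ℝ) →+ Torus d := QuotientAddGroup.mk' (intLattice d)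

/-- A quasilattice in `ℝ^n`: the ℤ-span of a finite family of vectors spanning `ℝ^n`. -/
def IsQuasilattice {n : ℕ} (Q : AddSubgroup (Fin n → ℝ)) : Prop :=
  ∃ (m : ℕ) (v : Fin m → (Fin n → ℝ)),
    Submodule.span ℝ (Set.range v) = ⊤ ∧ Q = AddSubgroup.closure (Set.range v)

/-- The coordinate subspace `ℝ^I ⊆ ℝ^d`. -/
def coordSubspace {d : ℕ} (I : Set (Fin d)) : Submodule ℝ (Fin d → ℝ) where
  carrier := {x | ∀ j ∉ I, x j = 0}
  zero_mem' := fun j _ => rfl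
  add_mem' := by intro a b ha hb j hj; simp [ha j hj, hb j hj]
  smul_mem' := by intro c x hx j hj; simp [hx j hj]

/-- The subtorus `T^I ⊆ T^d`, the image of `ℝ^I` under the quotient map. -/
def subTorus {d : ℕ} (I : Set (Fin d)) : AddSubgroup (Torus d) :=
  ((coordSubspace I).toAddSubgroup).map (torusMk d)

/-- The group `N = ker(Π : T^d → ℝ^n/Q)`. -/
def NGroup {n d : ℕ} (π : (Fin d → ℝ) →ₗ[ℝ] (Fin n → ℝ)) (Q : AddSubgroup (Fin n → ℝ))
    (hmap : intLattice d ≤ Q.comap π.toAddMonoidHom) : AddSubgroup (Torus d) :=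
  (QuotientAddGroup.map (intLattice d) Q π.toAddMonoidHom hmap).ker

/-- The standard pairing identifying `(ℝ^m)^*` with `ℝ^m`. -/
def pairR {m : ℕ} (μ x : Fin m → ℝ) : ℝ := ∑ i, μ i * x i

/-- The moment map `Υ(z) = Σ_j (|z_j|² + λ_j) e_j^*`, as a covector in `(ℝ^d)^* ≅ ℝ^d`. -/
def UpsilonV {d : ℕ} (lam : Fin d → ℝ) (z : Fin d → ℂ) : Fin d → ℝ :=
  fun j => ‖z j‖ ^ 2 + lam j

/-- The dual map `π^* : (ℝ^n)^* → (ℝ^d)^*`, `(π^*μ)_j = ⟨μ, X_j⟩`. -/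
def piStar {n d : ℕ} (X : Fin d → (Fin n → ℝ)) (μ : Fin n → ℝ) : Fin d → ℝ :=
  fun j => pairR μ (X j)

/-- The zero level set `Z = {z ∈ ℂ^d : Υ(z) vanishes on ker π}`. -/
def ZSet {n d : ℕ} (π : (Fin d → ℝ) →ₗ[ℝ] (Fin n → ℝ)) (lam : Fin d → ℝ) :
    Set (Fin d → ℂ) :=
  {z | ∀ x ∈ LinearMap.ker π, pairR (UpsilonV lam z) x = 0}

/-- The polyhedron `Δ = {μ : ⟨μ, X_j⟩ ≥ λ_j for all j}`. -/
def DeltaSet {n d : ℕ} (X : Fin d → (Fin n → ℝ)) (lam : Fin d → ℝ) :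
    Set (Fin n → ℝ) :=
  {μ | ∀ j, lam j ≤ pairR μ (X j)}

/-- The rotation action of `θ ∈ ℝ^d` (a representative of a point of `T^d`) on `ℂ^d`. -/
def rotate {d : ℕ} (θ : Fin d → ℝ) (z : Fin d → ℂ) : Fin d → ℂ :=
  fun j => Complex.exp (((2 * Real.pi * θ j : ℝ) : ℂ) * Complex.I) * z j
/-- For every `ξ ∈ (ℝ^d)^*`, `ξ` lies in `Υ(Z)` iff `ξ = π^*(μ)` for some `μ ∈ Δ`;
in other words `Υ(Z) = π^*(Δ)`. -/
theorem stmt1 {n d : ℕ} (hn : 1 ≤ n) (hd : n ≤ d)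
    (X : Fin d → (Fin n → ℝ)) (hX : Submodule.span ℝ (Set.range X) = ⊤)
    (lam : Fin d → ℝ)
    (π : (Fin d → ℝ) →ₗ[ℝ] (Fin n → ℝ)) (hπ : ∀ j, π (Pi.single j 1) = X j) :
    (∀ ξ : Fin d → ℝ,
      ξ ∈ UpsilonV lam '' ZSet π lam ↔ ∃ μ ∈ DeltaSet X lam, ξ = piStar X μ) ∧
    UpsilonV lam '' ZSet π lam = piStar X '' DeltaSet X lam := by
  have key : ∀ ξ : Fin d → ℝ,
      ξ ∈ UpsilonV lam '' ZSet π lam ↔ ∃ μ ∈ DeltaSet X lam, ξ = piStar X μ := by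
    intro ξ
    constructor
    · rintro ⟨z, hz, rfl⟩
      let f : Module.Dual ℝ (Fin d → ℝ) :=
        ∑ j, (UpsilonV lam z j) • (LinearMap.proj j : (Fin d → ℝ) →ₗ[ℝ] ℝ)
      have hf : ∀ x, f x = pairR (UpsilonV lam z) x := by
        intro x
        simp [f, pairR, LinearMap.sum_apply]
      have hmem : f ∈ LinearMap.range π.dualMap := by
        rw [LinearMap.range_dualMap_eq_dualAnnihilator_ker, Submodule.mem_dualAnnihilator]
        intro x hx
        rw [hf]
        exact hz x hx
      obtain ⟨g, hg⟩ := hmem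
      have hgp : ∀ y, g y = pairR (fun i => g (Pi.single i 1)) y := by
        intro y
        rw [LinearMap.pi_apply_eq_sum_univ g y]
        unfold pairR
        refine Finset.sum_congr rfl fun i _ => ?_
        rw [smul_eq_mul, mul_comm]
        congr 2
        ext k
        simp [Pi.single_apply, eq_comm]
      have hval : ∀ j, UpsilonV lam z j = pairR (fun i => g (Pi.single i 1)) (X j) := by
        intro j
        rw [← hgp, ← hπ j]
        have h1 : f (Pi.single j 1) = g (π (Pi.single j 1)) := by
          rw [← hg]; rfl
        rw [← h1, hf]
        simp [pairR, Pi.single_apply]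
      refine ⟨fun i => g (Pi.single i 1), fun j => ?_, funext hval⟩
      rw [← hval j]
      unfold UpsilonV
      nlinarith [sq_nonneg ‖z j‖]
    · rintro ⟨μ, hμ, rfl⟩
      have hU : UpsilonV lam (fun j => ((Real.sqrt (pairR μ (X j) - lam j) : ℝ) : ℂ))
          = piStar X μ := by
        funext j
        have h : 0 ≤ pairR μ (X j) - lam j := sub_nonneg.mpr (hμ j)
        simp [UpsilonV, piStar, Real.sq_sqrt h]
      refine ⟨_, ?_, hU⟩
      intro x hx
      rw [hU]
      have hx0 : π x = 0 := hx
      have hpx : π x = ∑ j, x j • X j := by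
        rw [LinearMap.pi_apply_eq_sum_univ π x]
        refine Finset.sum_congr rfl fun j _ => ?_
        rw [← hπ j]
        congr 2
        ext k
        simp [Pi.single_apply, eq_comm]
      have h2 : pairR μ (π x) = pairR (piStar X μ) x := by
        rw [hpx]
        simp only [pairR, piStar, Finset.sum_apply, Pi.smul_apply, smul_eq_mul,
          Finset.mul_sum, Finset.sum_mul]
        rw [Finset.sum_comm]
        refine Finset.sum_congr rfl fun j _ => Finset.sum_congr rfl fun i _ => ?_
        ring
      rw [← h2, hx0]
      simp [pairR]
  refine ⟨key, ?_⟩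
  ext ξ
  rw [key ξ]
  constructor
  · rintro ⟨μ, h, rfl⟩
    exact ⟨μ, h, rfl⟩
  · rintro ⟨μ, h, rfl⟩
    exact ⟨μ, h, rfl⟩

end
end

section
/- If the polyhedron Δ is bounded, then the zero level set Z = {z ∈ ℂ^d : Υ(z) vanishes on ker π} is a compact subset of ℂ^d. -/
noncomputable section

open scoped BigOperators

/-- If the polyhedron `Δ` is bounded then the zero level set `Z` is compact. -/
theorem stmt2 {n d : ℕ} (hn : 1 ≤ n) (hd : n ≤ d)
    (X : Fin d → (Fin n → ℝ)) (hX : Submodule.span ℝ (Set.range X) = ⊤)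
    (lam : Fin d → ℝ)
    (π : (Fin d → ℝ) →ₗ[ℝ] (Fin n → ℝ)) (hπ : ∀ j, π (Pi.single j 1) = X j)
    (hbd : Bornology.IsBounded (DeltaSet X lam)) :
    IsCompact (ZSet π lam) := by
  have hcont : ∀ j, Continuous fun μ : Fin n → ℝ => pairR μ (X j) := by
    intro j
    unfold pairR
    fun_prop
  have hclosed : IsClosed (ZSet π lam) := by
    have : ZSet π lam = ⋂ x ∈ LinearMap.ker π, {z | pairR (UpsilonV lam z) x = 0} := by
      ext z
      simp [ZSet]
    rw [this]
    refine isClosed_biInter fun x _ => isClosed_eq ?_ continuous_const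
    unfold pairR UpsilonV
    fun_prop
  -- every point of `Z` comes from a point of `Δ`
  have hkey : ∀ z ∈ ZSet π lam, ∃ μ ∈ DeltaSet X lam,
      ∀ j, pairR μ (X j) = ‖z j‖ ^ 2 + lam j := by
    intro z hz
    let f : Module.Dual ℝ (Fin d → ℝ) := ∑ j, UpsilonV lam z j • LinearMap.proj j
    have hf : ∀ x, f x = pairR (UpsilonV lam z) x := by
      intro x
      simp [f, pairR, LinearMap.sum_apply]
    have hmem : f ∈ (LinearMap.ker π).dualAnnihilator := by
      rw [Submodule.mem_dualAnnihilator]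
      intro x hx
      rw [hf]
      exact hz x hx
    rw [← LinearMap.range_dualMap_eq_dualAnnihilator_ker] at hmem
    obtain ⟨g, hg⟩ := hmem
    have hmu : ∀ j, pairR (fun i => g (Pi.single i 1)) (X j) = ‖z j‖ ^ 2 + lam j := by
      intro j
      have h1 : pairR (fun i => g (Pi.single i 1)) (X j) = g (X j) := by
        rw [LinearMap.pi_apply_eq_sum_univ g (X j)]
        simp only [pairR, smul_eq_mul]
        refine Finset.sum_congr rfl fun i _ => ?_
        rw [mul_comm]
        congr 2
        ext k
        simp [Pi.single_apply, eq_comm]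
      have h2 : g (X j) = f (Pi.single j 1) := by
        rw [← hg, LinearMap.dualMap_apply, hπ]
      rw [h1, h2, hf]
      simp [pairR, UpsilonV, Pi.single_apply]
    refine ⟨_, fun j => ?_, hmu⟩
    rw [hmu j]
    nlinarith [sq_nonneg ‖z j‖]
  have hK : IsCompact (closure (DeltaSet X lam)) := hbd.isCompact_closure
  have hB : ∀ j, ∃ B : ℝ, ∀ μ ∈ DeltaSet X lam, pairR μ (X j) ≤ B := by
    intro j
    obtain ⟨B, hB⟩ := hK.bddAbove_image (hcont j).continuousOn
    exact ⟨B, fun μ hμ => hB ⟨μ, subset_closure hμ, rfl⟩⟩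
  choose B hB using hB
  have hbdZ : Bornology.IsBounded (ZSet π lam) := by
    rw [← Bornology.forall_isBounded_image_eval_iff]
    intro j
    rw [isBounded_iff_forall_norm_le]
    refine ⟨B j - lam j + 1, ?_⟩
    rintro _ ⟨z, hz, rfl⟩
    obtain ⟨μ, hμ, h⟩ := hkey z hz
    have h1 := hB j μ hμ
    rw [h j] at h1
    simp only [Function.eval]
    nlinarith [sq_nonneg (‖z j‖ - 1 / 2)]
  exact Metric.isCompact_of_isClosed_isBounded hclosed hbdZ

end
end

section
/- For every z ∈ Z there is a unique μ ∈ (ℝ^n)^* with Υ(z) = π^*(μ); this μ belongs to Δ and satisfies |z_j|² = ⟨μ, X_j⟩ − λ_j for every j = 1, …, d; in particular z_j = 0 if and only if ⟨μ, X_j⟩ = λ_j, so the zero coordinate pattern of z records exactly the face of Δ containing μ. -/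
noncomputable section

open scoped BigOperators

/-- For every `z ∈ Z` there is a unique `μ` with `Υ(z) = π^*(μ)`; this `μ` lies in `Δ` and
`|z_j|² = ⟨μ, X_j⟩ − λ_j` for all `j`; in particular `z_j = 0 ↔ ⟨μ, X_j⟩ = λ_j`. -/
theorem stmt3 {n d : ℕ} (hn : 1 ≤ n) (hd : n ≤ d)
    (X : Fin d → (Fin n → ℝ)) (hX : Submodule.span ℝ (Set.range X) = ⊤)
    (lam : Fin d → ℝ)
    (π : (Fin d → ℝ) →ₗ[ℝ] (Fin n → ℝ)) (hπ : ∀ j, π (Pi.single j 1) = X j) :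
    ∀ z ∈ ZSet π lam,
      (∃! μ : Fin n → ℝ, UpsilonV lam z = piStar X μ) ∧
      ∀ μ : Fin n → ℝ, UpsilonV lam z = piStar X μ →
        μ ∈ DeltaSet X lam ∧
        ∀ j, ‖z j‖ ^ 2 = pairR μ (X j) - lam j ∧ (z j = 0 ↔ pairR μ (X j) = lam j) := by
  intro z hz
  have hpd : ∀ {m : ℕ} (a b : Fin m → ℝ), pairR a b = dotProductBilin ℝ ℝ a b := by
    intro m a b
    rfl
  refine ⟨?_, ?_⟩
  · have hsurj : LinearMap.range π = ⊤ := by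
      rw [eq_top_iff, ← hX, Submodule.span_le]
      rintro _ ⟨j, rfl⟩
      exact ⟨_, hπ j⟩
    obtain ⟨s, hs⟩ := π.exists_rightInverse_of_surjective hsurj
    have hs' : ∀ x, π (s x) = x := fun x => LinearMap.congr_fun hs x
    let f : (Fin n → ℝ) →ₗ[ℝ] ℝ := (dotProductBilin ℝ ℝ (UpsilonV lam z)).comp s
    have hf : ∀ x, pairR (fun i => f (Pi.single i 1)) x = f x := by
      intro x
      rw [LinearMap.pi_apply_eq_sum_univ f x]
      simp only [pairR, smul_eq_mul]
      refine Finset.sum_congr rfl fun i _ => ?_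
      rw [mul_comm]
      congr 2
      ext k
      simp [Pi.single_apply, eq_comm]
    refine ⟨fun i => f (Pi.single i 1), ?_, ?_⟩
    · funext j
      show _ = pairR _ (X j)
      rw [hf]
      have h := hz (Pi.single j 1 - s (X j)) (by
        rw [LinearMap.mem_ker, map_sub, hπ, hs', sub_self])
      rw [hpd, map_sub, sub_eq_zero] at h
      have h2 : UpsilonV lam z j = dotProductBilin ℝ ℝ (UpsilonV lam z) (Pi.single j 1) := by
        simp
      rw [h2, h]
      rfl
    · intro ν hν
      have key : dotProductBilin ℝ ℝ ν = f := by
        apply LinearMap.ext_on hX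
        rintro _ ⟨j, rfl⟩
        have h := hz (Pi.single j 1 - s (X j)) (by
          rw [LinearMap.mem_ker, map_sub, hπ, hs', sub_self])
        rw [hpd, map_sub, sub_eq_zero] at h
        have h2 : UpsilonV lam z j = dotProductBilin ℝ ℝ (UpsilonV lam z) (Pi.single j 1) := by
          simp
        exact (congrFun hν j).symm.trans (h2.trans h)
      funext i
      rw [← key]
      simp
  · intro μ hμ
    have h : ∀ j, ‖z j‖ ^ 2 + lam j = pairR μ (X j) := fun j => congrFun hμ j
    refine ⟨fun j => ?_, fun j => ⟨?_, ?_⟩⟩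
    · have := sq_nonneg ‖z j‖
      linarith [h j]
    · linarith [h j]
    · rw [← h j]
      simp

end
end

section
/- Assume Δ is bounded. The map Υ is constant on T^d-orbits in Z, and the induced map from the orbit space Z/T^d (with the quotient topology) to (ℝ^d)^* is a homeomorphism onto π^*(Δ) (with the subspace topology); composing with (π^*)^{-1}, the orbit space Z/T^d is homeomorphic to the polytope Δ. -/
noncomputable section

open scoped BigOperators

/-- The orbit equivalence relation of the coordinatewise rotation action of `T^d` on a
subset of `ℂ^d`. -/
def orbitSetoid {d : ℕ} (Z : Set (Fin d → ℂ)) : Setoid ↥Z where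
  r z w := ∃ θ : Fin d → ℝ, rotate θ (z : Fin d → ℂ) = (w : Fin d → ℂ)
  iseqv := by
    constructor
    · intro z
      refine ⟨0, ?_⟩
      funext j
      simp [rotate]
    · rintro z w ⟨θ, h⟩
      refine ⟨-θ, ?_⟩
      funext j
      have hj := congrFun h j
      simp only [rotate] at hj ⊢
      rw [← hj, ← mul_assoc, ← Complex.exp_add]
      have : (((2 * Real.pi * (-θ) j : ℝ) : ℂ) * Complex.I
          + ((2 * Real.pi * θ j : ℝ) : ℂ) * Complex.I) = 0 := by
        simp only [Pi.neg_apply]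
        push_cast
        ring_nf
      rw [this, Complex.exp_zero, one_mul]
    · rintro x y z ⟨θ, h1⟩ ⟨η, h2⟩
      refine ⟨θ + η, ?_⟩
      funext j
      have h1j := congrFun h1 j
      have h2j := congrFun h2 j
      simp only [rotate] at h1j h2j ⊢
      rw [← h2j, ← h1j, ← mul_assoc, ← Complex.exp_add]
      congr 1
      simp only [Pi.add_apply]
      push_cast
      ring_nf

theorem pi_apply_aux {n d : ℕ} (X : Fin d → (Fin n → ℝ))
    (π : (Fin d → ℝ) →ₗ[ℝ] (Fin n → ℝ)) (hπ : ∀ j, π (Pi.single j 1) = X j)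
    (x : Fin d → ℝ) : π x = ∑ j, x j • X j := by
  rw [LinearMap.pi_apply_eq_sum_univ π x]
  refine Finset.sum_congr rfl fun j _ => ?_
  rw [← hπ j]
  congr 2
  funext k
  simp [Pi.single_apply, eq_comm]

theorem pairR_piStar_aux {n d : ℕ} (X : Fin d → (Fin n → ℝ))
    (π : (Fin d → ℝ) →ₗ[ℝ] (Fin n → ℝ)) (hπ : ∀ j, π (Pi.single j 1) = X j)
    (μ : Fin n → ℝ) (x : Fin d → ℝ) : pairR (piStar X μ) x = pairR μ (π x) := by
  rw [pi_apply_aux X π hπ]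
  simp only [pairR, piStar, Finset.sum_apply, Pi.smul_apply, smul_eq_mul, Finset.mul_sum,
    Finset.sum_mul]
  rw [Finset.sum_comm]
  refine Finset.sum_congr rfl fun i _ => Finset.sum_congr rfl fun j _ => by ring

/-- `pairR u` as a functional. -/
def pairLin {m : ℕ} (u : Fin m → ℝ) : (Fin m → ℝ) →ₗ[ℝ] ℝ where
  toFun x := pairR u x
  map_add' x y := by simp [pairR, mul_add, Finset.sum_add_distrib]
  map_smul' c x := by
    simp only [pairR, Pi.smul_apply, smul_eq_mul, Finset.mul_sum, RingHom.id_apply]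
    exact Finset.sum_congr rfl fun i _ => by ring

/-- `piStar` as a linear map. -/
def piStarLin {n d : ℕ} (X : Fin d → (Fin n → ℝ)) : (Fin n → ℝ) →ₗ[ℝ] (Fin d → ℝ) where
  toFun := piStar X
  map_add' x y := by
    funext j
    simp [piStar, pairR, add_mul, Finset.sum_add_distrib]
  map_smul' c x := by
    funext j
    simp only [piStar, pairR, Pi.smul_apply, smul_eq_mul, Finset.mul_sum, RingHom.id_apply]
    exact Finset.sum_congr rfl fun i _ => by ring

theorem exists_piStar_aux {n d : ℕ} (X : Fin d → (Fin n → ℝ))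
    (π : (Fin d → ℝ) →ₗ[ℝ] (Fin n → ℝ)) (hπ : ∀ j, π (Pi.single j 1) = X j)
    (u : Fin d → ℝ) (hu : ∀ x ∈ LinearMap.ker π, pairR u x = 0) :
    ∃ μ, piStar X μ = u := by
  have h1 : pairLin u ∈ (LinearMap.ker π).dualAnnihilator := by
    rw [Submodule.mem_dualAnnihilator]
    exact hu
  rw [← LinearMap.range_dualMap_eq_dualAnnihilator_ker] at h1
  obtain ⟨f, hf⟩ := h1
  refine ⟨fun i => f (Pi.single i 1), ?_⟩
  funext j
  have h2 : f (X j) = u j := by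
    have := LinearMap.congr_fun hf (Pi.single j 1)
    rw [LinearMap.dualMap_apply, hπ] at this
    rw [this]
    simp [pairLin, pairR, Pi.single_apply]
  rw [← h2, LinearMap.pi_apply_eq_sum_univ f (X j)]
  simp only [piStar, pairR, smul_eq_mul]
  refine Finset.sum_congr rfl fun i _ => ?_
  rw [mul_comm]
  congr 2
  funext k
  simp [Pi.single_apply, eq_comm]

theorem piStar_inj_aux {n d : ℕ} (X : Fin d → (Fin n → ℝ))
    (hX : Submodule.span ℝ (Set.range X) = ⊤) : Function.Injective (piStarLin X) := by
  rw [← LinearMap.ker_eq_bot, LinearMap.ker_eq_bot']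
  intro μ hμ
  have h : pairLin μ = 0 := by
    apply LinearMap.ext_on_range hX
    intro j
    exact congrFun hμ j
  funext i
  have := LinearMap.congr_fun h (Pi.single i 1)
  simpa [pairLin, pairR, Pi.single_apply] using this

theorem norm_rotate_aux {d : ℕ} (θ : Fin d → ℝ) (z : Fin d → ℂ) (j : Fin d) :
    ‖rotate θ z j‖ = ‖z j‖ := by
  rw [rotate, norm_mul, Complex.norm_exp_ofReal_mul_I, one_mul]

theorem exists_rotate_aux {d : ℕ} (z w : Fin d → ℂ) (h : ∀ j, ‖z j‖ = ‖w j‖) :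
    ∃ θ : Fin d → ℝ, rotate θ z = w := by
  refine ⟨fun j => Complex.arg (w j / z j) / (2 * Real.pi), ?_⟩
  funext j
  have hp : (2 * Real.pi : ℝ) ≠ 0 := by positivity
  simp only [rotate]
  rw [mul_div_cancel₀ _ hp]
  by_cases hz : z j = 0
  · have := h j
    rw [hz, norm_zero] at this
    rw [hz, norm_eq_zero.mp this.symm, mul_zero]
  · have h1 : ‖w j / z j‖ = 1 := by
      rw [norm_div, h j, div_self]
      rw [← h j]
      exact norm_ne_zero_iff.mpr hz
    have h2 := Complex.norm_mul_exp_arg_mul_I (w j / z j)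
    rw [h1, Complex.ofReal_one, one_mul] at h2
    rw [h2, div_mul_cancel₀ _ hz]

theorem continuous_Upsilon_aux {d : ℕ} (lam : Fin d → ℝ) :
    Continuous (UpsilonV lam) := by
  unfold UpsilonV
  fun_prop

theorem Upsilon_sqrt_aux {d : ℕ} (lam p : Fin d → ℝ) (h : ∀ j, lam j ≤ p j) :
    UpsilonV lam (fun j => ((Real.sqrt (p j - lam j) : ℝ) : ℂ)) = p := by
  funext j
  simp only [UpsilonV]
  rw [Complex.norm_real, Real.norm_eq_abs, sq_abs, Real.sq_sqrt (sub_nonneg.mpr (h j))]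
  ring

/-- Assume `Δ` is bounded. `Υ` is constant on `T^d`-orbits in `Z`, and the induced map on
the orbit space `Z/T^d` is a homeomorphism onto `π^*(Δ)`; composing with `(π^*)⁻¹`, the
orbit space `Z/T^d` is homeomorphic to the polytope `Δ`. -/
theorem stmt4 {n d : ℕ} (hn : 1 ≤ n) (hd : n ≤ d)
    (X : Fin d → (Fin n → ℝ)) (hX : Submodule.span ℝ (Set.range X) = ⊤)
    (lam : Fin d → ℝ)
    (π : (Fin d → ℝ) →ₗ[ℝ] (Fin n → ℝ)) (hπ : ∀ j, π (Pi.single j 1) = X j)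
    (hbd : Bornology.IsBounded (DeltaSet X lam)) :
    (∀ z w : ↥(ZSet π lam), (orbitSetoid (ZSet π lam)).r z w →
      UpsilonV lam (z : Fin d → ℂ) = UpsilonV lam (w : Fin d → ℂ)) ∧
    (∃ h : Quotient (orbitSetoid (ZSet π lam)) ≃ₜ ↥(piStar X '' DeltaSet X lam),
      ∀ z : ↥(ZSet π lam),
        (h (Quotient.mk (orbitSetoid (ZSet π lam)) z) : Fin d → ℝ)
          = UpsilonV lam (z : Fin d → ℂ)) ∧
    (∃ g : Quotient (orbitSetoid (ZSet π lam)) ≃ₜ ↥(DeltaSet X lam),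
      ∀ z : ↥(ZSet π lam),
        piStar X ((g (Quotient.mk (orbitSetoid (ZSet π lam)) z) : Fin n → ℝ))
          = UpsilonV lam (z : Fin d → ℂ)) := by
  have hconst : ∀ z w : ↥(ZSet π lam), (orbitSetoid (ZSet π lam)).r z w →
      UpsilonV lam (z : Fin d → ℂ) = UpsilonV lam (w : Fin d → ℂ) := by
    rintro z w ⟨θ, h⟩
    funext j
    simp only [UpsilonV]
    rw [← h, norm_rotate_aux]
  have hmem : ∀ z : ↥(ZSet π lam),
      UpsilonV lam (z : Fin d → ℂ) ∈ piStar X '' DeltaSet X lam := by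
    intro z
    obtain ⟨μ, hμ⟩ := exists_piStar_aux X π hπ _ z.2
    refine ⟨μ, fun j => ?_, hμ⟩
    have := congrFun hμ j
    simp only [piStar, UpsilonV] at this
    rw [this]
    have := sq_nonneg ‖(z : Fin d → ℂ) j‖
    linarith
  have hle : ∀ p : ↥(piStar X '' DeltaSet X lam), ∀ j, lam j ≤ (p : Fin d → ℝ) j := by
    rintro ⟨p, μ, hμ, rfl⟩ j
    exact hμ j
  have hZ : ∀ p : ↥(piStar X '' DeltaSet X lam),
      (fun j => ((Real.sqrt ((p : Fin d → ℝ) j - lam j) : ℝ) : ℂ)) ∈ ZSet π lam := by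
    intro p x hx
    rw [Upsilon_sqrt_aux lam _ (hle p)]
    obtain ⟨p, μ, hμ, rfl⟩ := p
    simp only
    rw [pairR_piStar_aux X π hπ, LinearMap.mem_ker.mp hx]
    simp [pairR]
  let h : Quotient (orbitSetoid (ZSet π lam)) ≃ₜ ↥(piStar X '' DeltaSet X lam) :=
    { toFun := Quotient.lift (fun z => ⟨UpsilonV lam (z : Fin d → ℂ), hmem z⟩)
        (fun z w hzw => Subtype.ext (hconst z w hzw))
      invFun := fun p => Quotient.mk _ ⟨_, hZ p⟩
      left_inv := by
        intro q
        induction q using Quotient.inductionOn with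
        | h z =>
          apply Quotient.sound
          apply exists_rotate_aux
          intro j
          have h1 := congrFun (Upsilon_sqrt_aux lam _
            (hle ⟨UpsilonV lam (z : Fin d → ℂ), hmem z⟩)) j
          simp only [UpsilonV, add_left_inj] at h1
          exact (sq_eq_sq₀ (norm_nonneg _) (norm_nonneg _)).mp h1
      right_inv := fun p => Subtype.ext (Upsilon_sqrt_aux lam _ (hle p))
      continuous_toFun := by
        apply Continuous.quotient_lift
        exact ((continuous_Upsilon_aux lam).comp continuous_subtype_val).subtype_mk _
      continuous_invFun := by
        refine continuous_quotient_mk'.comp (Continuous.subtype_mk ?_ _)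
        refine continuous_pi fun j => Complex.continuous_ofReal.comp
          (Real.continuous_sqrt.comp (Continuous.sub ?_ continuous_const))
        exact (continuous_apply j).comp continuous_subtype_val }
  obtain ⟨L, hL⟩ := LinearMap.exists_leftInverse_of_injective (piStarLin X)
    (LinearMap.ker_eq_bot.mpr (piStar_inj_aux X hX))
  have hL' : ∀ μ, L (piStar X μ) = μ := fun μ => LinearMap.congr_fun hL μ
  have hLc : Continuous L := LinearMap.continuous_of_finiteDimensional L
  have hPc : Continuous (piStar X) :=
    LinearMap.continuous_of_finiteDimensional (piStarLin X)
  have hLm : ∀ p : ↥(piStar X '' DeltaSet X lam), L (p : Fin d → ℝ) ∈ DeltaSet X lam := by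
    rintro ⟨p, μ, hμ, rfl⟩
    simpa only [hL'] using hμ
  let e : ↥(piStar X '' DeltaSet X lam) ≃ₜ ↥(DeltaSet X lam) :=
    { toFun := fun p => ⟨L p, hLm p⟩
      invFun := fun μ => ⟨piStar X μ, μ, μ.2, rfl⟩
      left_inv := by
        rintro ⟨p, μ, hμ, rfl⟩
        simp only [hL']
      right_inv := fun μ => Subtype.ext (hL' μ)
      continuous_toFun := (hLc.comp continuous_subtype_val).subtype_mk hLm
      continuous_invFun := (hPc.comp continuous_subtype_val).subtype_mk _ }
  refine ⟨hconst, ⟨h, fun z => rfl⟩, ⟨h.trans e, fun z => ?_⟩⟩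
  exact congrArg Subtype.val (e.left_inv ⟨UpsilonV lam (z : Fin d → ℂ), hmem z⟩)

end
end

section
/- Suppose I ⊆ {1,…,d} is such that {X_j : j ∈ I} is a basis of ℝ^n. Then the homomorphism λ_I : N → T^d/T^I obtained by restricting the quotient map T^d → T^d/T^I to N is surjective and its kernel is Γ_I = N ∩ T^I; consequently λ_I induces a group isomorphism N/Γ_I ≅ T^d/T^I. -/
noncomputable section

open scoped BigOperators

/-- If `{X_j : j ∈ I}` is a basis of `ℝ^n`, the restriction `λ_I : N → T^d/T^I` of the
quotient map is surjective with kernel `Γ_I = N ∩ T^I`, inducing `N/Γ_I ≅ T^d/T^I`. -/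
theorem stmt5 {n d : ℕ} (hn : 1 ≤ n) (hd : n ≤ d)
    (X : Fin d → (Fin n → ℝ)) (hX : Submodule.span ℝ (Set.range X) = ⊤)
    (π : (Fin d → ℝ) →ₗ[ℝ] (Fin n → ℝ)) (hπ : ∀ j, π (Pi.single j 1) = X j)
    (Q : AddSubgroup (Fin n → ℝ)) (hQ : IsQuasilattice Q) (hXQ : ∀ j, X j ∈ Q)
    (hmap : intLattice d ≤ Q.comap π.toAddMonoidHom)
    (I : Set (Fin d))
    (hI1 : LinearIndependent ℝ (fun j : I => X j))
    (hI2 : Submodule.span ℝ (X '' I) = ⊤) :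
    Function.Surjective
      ((QuotientAddGroup.mk' (subTorus I)).comp (NGroup π Q hmap).subtype) ∧
    ((QuotientAddGroup.mk' (subTorus I)).comp (NGroup π Q hmap).subtype).ker
      = (NGroup π Q hmap ⊓ subTorus I).addSubgroupOf (NGroup π Q hmap) ∧
    Nonempty ((↥(NGroup π Q hmap) ⧸
        (NGroup π Q hmap ⊓ subTorus I).addSubgroupOf (NGroup π Q hmap))
      ≃+ (Torus d ⧸ subTorus I)) := by
  have hsurj : Function.Surjective
      ((QuotientAddGroup.mk' (subTorus I)).comp (NGroup π Q hmap).subtype) := by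
    intro t
    obtain ⟨s, rfl⟩ := QuotientAddGroup.mk_surjective t
    obtain ⟨x, rfl⟩ := QuotientAddGroup.mk_surjective s
    have hle : Submodule.span ℝ (X '' I) ≤ (coordSubspace I).map π := by
      rw [Submodule.span_le]
      rintro _ ⟨j, hj, rfl⟩
      refine ⟨Pi.single j 1, ?_, hπ j⟩
      intro k hk
      have hkj : k ≠ j := fun h => hk (h ▸ hj)
      simp [hkj]
    have hx : π x ∈ (coordSubspace I).map π := hle (by rw [hI2]; trivial)
    obtain ⟨y, hy, hyx⟩ := hx
    refine ⟨⟨torusMk d (x - y), ?_⟩, ?_⟩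
    · change QuotientAddGroup.map (intLattice d) Q π.toAddMonoidHom hmap
        (QuotientAddGroup.mk (x - y)) = 0
      rw [QuotientAddGroup.map_mk]
      have h0 : π.toAddMonoidHom (x - y) = 0 := by
        change π (x - y) = 0
        rw [map_sub, hyx, sub_self]
      rw [h0]
      rfl
    · change (QuotientAddGroup.mk (torusMk d (x - y)) : Torus d ⧸ subTorus I)
        = QuotientAddGroup.mk (torusMk d x)
      rw [QuotientAddGroup.eq]
      refine ⟨y, hy, ?_⟩
      rw [← map_neg, ← map_add]
      congr 1
      abel
  have hker : ((QuotientAddGroup.mk' (subTorus I)).comp (NGroup π Q hmap).subtype).ker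
      = (NGroup π Q hmap ⊓ subTorus I).addSubgroupOf (NGroup π Q hmap) := by
    ext a
    rw [AddMonoidHom.mem_ker, AddSubgroup.mem_addSubgroupOf, AddSubgroup.mem_inf]
    change (QuotientAddGroup.mk (a : Torus d) : Torus d ⧸ subTorus I) = 0 ↔ _
    rw [QuotientAddGroup.eq_zero_iff]
    exact ⟨fun h => ⟨a.2, h⟩, fun h => h.2⟩
  refine ⟨hsurj, hker, ?_⟩
  rw [← hker]
  exact ⟨QuotientAddGroup.quotientKerEquivOfSurjective _ hsurj⟩

end
end

section
/- Suppose I ⊆ {1,…,d} is such that {X_j : j ∈ I} is a basis of ℝ^n. Then N = Γ_I · exp(𝔫): every element a ∈ N can be written (not necessarily uniquely) as a = g + [X] with g ∈ Γ_I and X ∈ 𝔫 = ker π, where [·] : ℝ^d → T^d is the quotient map. -/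
noncomputable section

open scoped BigOperators

/-- If `{X_j : j ∈ I}` is a basis of `ℝ^n`, then `N = Γ_I · exp(𝔫)`: every `a ∈ N` can be
written as `a = g + [X]` with `g ∈ Γ_I = N ∩ T^I` and `X ∈ 𝔫 = ker π`. -/
theorem stmt6 {n d : ℕ} (hn : 1 ≤ n) (hd : n ≤ d)
    (X : Fin d → (Fin n → ℝ)) (hX : Submodule.span ℝ (Set.range X) = ⊤)
    (π : (Fin d → ℝ) →ₗ[ℝ] (Fin n → ℝ)) (hπ : ∀ j, π (Pi.single j 1) = X j)
    (Q : AddSubgroup (Fin n → ℝ)) (hQ : IsQuasilattice Q) (hXQ : ∀ j, X j ∈ Q)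
    (hmap : intLattice d ≤ Q.comap π.toAddMonoidHom)
    (I : Set (Fin d))
    (hI1 : LinearIndependent ℝ (fun j : I => X j))
    (hI2 : Submodule.span ℝ (X '' I) = ⊤) :
    ∀ a ∈ NGroup π Q hmap, ∃ g ∈ NGroup π Q hmap ⊓ subTorus I,
      ∃ x ∈ LinearMap.ker π, a = g + torusMk d x := by
  intro a ha
  obtain ⟨y, rfl⟩ := QuotientAddGroup.mk_surjective a
  have hle : (⊤ : Submodule ℝ (Fin n → ℝ)) ≤ (coordSubspace I).map π := by
    rw [← hI2, Submodule.span_le]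
    rintro _ ⟨j, hj, rfl⟩
    refine ⟨Pi.single j 1, ?_, hπ j⟩
    intro k hk
    have hne : k ≠ j := fun h => hk (h ▸ hj)
    simp [hne]
  obtain ⟨w, hw, hwy⟩ := hle (Submodule.mem_top (x := π y))
  have hx : y - w ∈ LinearMap.ker π := by
    rw [LinearMap.mem_ker, map_sub, hwy, sub_self]
  have hNy : (QuotientAddGroup.mk (π y) : (Fin n → ℝ) ⧸ Q) = 0 := ha
  refine ⟨torusMk d w, ⟨?_, ⟨w, hw, rfl⟩⟩, y - w, hx, ?_⟩
  · change (QuotientAddGroup.mk (π w) : (Fin n → ℝ) ⧸ Q) = 0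
    rw [hwy, hNy]
  · rw [← map_add, add_sub_cancel]
    rfl


end
end

section
/- Let I_F ⊆ {1,…,d} and let I ⊆ {1,…,d} be such that {X_j : j ∈ I} is a basis of ℝ^n and the real span of {X_j : j ∈ I ∩ I_F} equals the real span of {X_j : j ∈ I_F}. Then the homomorphism N^F → T^F/T^{I∩I_F} obtained by restricting the quotient map T^F → T^F/T^{I∩I_F} to N^F is surjective with kernel Γ_{I∩I_F} = N^F ∩ T^{I∩I_F}; consequently it induces a group isomorphism N^F/Γ_{I∩I_F} ≅ T^F/T^{I∩I_F}. -/
noncomputable section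

open scoped BigOperators

theorem coord_pi_mem {n d : ℕ} (X : Fin d → (Fin n → ℝ))
    (π : (Fin d → ℝ) →ₗ[ℝ] (Fin n → ℝ)) (hπ : ∀ j, π (Pi.single j 1) = X j)
    (S : Set (Fin d)) (x : Fin d → ℝ) (hx : x ∈ coordSubspace S) :
    π x ∈ Submodule.span ℝ (X '' S) := by
  have h : x = ∑ j, x j • (Pi.single j 1 : Fin d → ℝ) := by
    ext i
    simp [Finset.sum_apply, Pi.single_apply]
  rw [h, map_sum]
  refine Submodule.sum_mem _ fun j _ => ?_
  rw [map_smul, hπ]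
  by_cases hj : j ∈ S
  · exact Submodule.smul_mem _ _ (Submodule.subset_span ⟨j, hj, rfl⟩)
  · rw [hx j hj, zero_smul]
    exact Submodule.zero_mem _

theorem exists_coord {n d : ℕ} (X : Fin d → (Fin n → ℝ))
    (π : (Fin d → ℝ) →ₗ[ℝ] (Fin n → ℝ)) (hπ : ∀ j, π (Pi.single j 1) = X j)
    (S : Set (Fin d)) (v : Fin n → ℝ) (hv : v ∈ Submodule.span ℝ (X '' S)) :
    ∃ y ∈ coordSubspace S, π y = v := by
  have h : Submodule.span ℝ (X '' S) ≤ (coordSubspace S).map π := by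
    rw [Submodule.span_le]
    rintro _ ⟨j, hj, rfl⟩
    refine ⟨Pi.single j 1, ?_, hπ j⟩
    intro k hk
    have : k ≠ j := by
      rintro rfl
      exact hk hj
    simp [Pi.single_apply, this]
  exact h hv

/-- If `{X_j : j ∈ I}` is a basis of `ℝ^n` and `span{X_j : j ∈ I ∩ I_F} = span{X_j : j ∈ I_F}`,
the restriction `N^F → T^F/T^{I∩I_F}` of the quotient map is surjective with kernel
`Γ_{I∩I_F} = N^F ∩ T^{I∩I_F}`, inducing `N^F/Γ_{I∩I_F} ≅ T^F/T^{I∩I_F}`. -/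
theorem stmt8 {n d : ℕ} (hn : 1 ≤ n) (hd : n ≤ d)
    (X : Fin d → (Fin n → ℝ)) (hX : Submodule.span ℝ (Set.range X) = ⊤)
    (π : (Fin d → ℝ) →ₗ[ℝ] (Fin n → ℝ)) (hπ : ∀ j, π (Pi.single j 1) = X j)
    (Q : AddSubgroup (Fin n → ℝ)) (hQ : IsQuasilattice Q) (hXQ : ∀ j, X j ∈ Q)
    (hmap : intLattice d ≤ Q.comap π.toAddMonoidHom)
    (I IF : Set (Fin d))
    (hI1 : LinearIndependent ℝ (fun j : I => X j))
    (hI2 : Submodule.span ℝ (X '' I) = ⊤)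
    (hIF : Submodule.span ℝ (X '' (I ∩ IF)) = Submodule.span ℝ (X '' IF)) :
    Function.Surjective
      ((QuotientAddGroup.mk' ((subTorus (I ∩ IF)).addSubgroupOf (subTorus IF))).comp
        (AddSubgroup.inclusion (inf_le_right :
          NGroup π Q hmap ⊓ subTorus IF ≤ subTorus IF))) ∧
    ((QuotientAddGroup.mk' ((subTorus (I ∩ IF)).addSubgroupOf (subTorus IF))).comp
        (AddSubgroup.inclusion (inf_le_right :
          NGroup π Q hmap ⊓ subTorus IF ≤ subTorus IF))).ker
      = ((NGroup π Q hmap ⊓ subTorus IF) ⊓ subTorus (I ∩ IF)).addSubgroupOf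
          (NGroup π Q hmap ⊓ subTorus IF) ∧
    Nonempty ((↥(NGroup π Q hmap ⊓ subTorus IF) ⧸
        ((NGroup π Q hmap ⊓ subTorus IF) ⊓ subTorus (I ∩ IF)).addSubgroupOf
          (NGroup π Q hmap ⊓ subTorus IF))
      ≃+ (↥(subTorus IF) ⧸ (subTorus (I ∩ IF)).addSubgroupOf (subTorus IF))) := by
  have hker : ((QuotientAddGroup.mk' ((subTorus (I ∩ IF)).addSubgroupOf (subTorus IF))).comp
        (AddSubgroup.inclusion (inf_le_right :
          NGroup π Q hmap ⊓ subTorus IF ≤ subTorus IF))).ker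
      = ((NGroup π Q hmap ⊓ subTorus IF) ⊓ subTorus (I ∩ IF)).addSubgroupOf
          (NGroup π Q hmap ⊓ subTorus IF) := by
    ext ⟨t, ht⟩
    rw [AddMonoidHom.mem_ker, AddMonoidHom.comp_apply, QuotientAddGroup.mk'_apply,
      QuotientAddGroup.eq_zero_iff, AddSubgroup.mem_addSubgroupOf, AddSubgroup.mem_addSubgroupOf]
    exact ⟨fun h => ⟨ht, h⟩, fun h => h.2⟩
  have hsurj : Function.Surjective
      ((QuotientAddGroup.mk' ((subTorus (I ∩ IF)).addSubgroupOf (subTorus IF))).comp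
        (AddSubgroup.inclusion (inf_le_right :
          NGroup π Q hmap ⊓ subTorus IF ≤ subTorus IF))) := by
    intro q
    obtain ⟨⟨t, ht⟩, rfl⟩ := QuotientAddGroup.mk'_surjective _ q
    obtain ⟨x, hx, rfl⟩ := ht
    obtain ⟨y, hy, hxy⟩ := exists_coord X π hπ (I ∩ IF) (π x)
      (by rw [hIF]; exact coord_pi_mem X π hπ IF x hx)
    have hy' : y ∈ coordSubspace IF := fun j hj => hy j fun h => hj h.2
    have hN : torusMk d (x - y) ∈ NGroup π Q hmap := by
      change ((π (x - y) : Fin n → ℝ) : (Fin n → ℝ) ⧸ Q) = 0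
      rw [map_sub, hxy, sub_self]
      rfl
    refine ⟨⟨torusMk d (x - y), hN, x - y, Submodule.sub_mem _ hx hy', rfl⟩, ?_⟩
    rw [AddMonoidHom.comp_apply, QuotientAddGroup.mk'_apply, QuotientAddGroup.mk'_apply,
      QuotientAddGroup.eq, AddSubgroup.mem_addSubgroupOf]
    refine ⟨y, hy, ?_⟩
    change torusMk d y = -(torusMk d (x - y)) + torusMk d x
    rw [map_sub]
    abel
  refine ⟨hsurj, hker, ⟨?_⟩⟩
  exact (QuotientAddGroup.quotientAddEquivOfEq hker.symm).trans
    (QuotientAddGroup.quotientKerEquivOfSurjective _ hsurj)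

end
end

section
/- Let I_F ⊆ {1,…,d} and let I ⊆ {1,…,d} be such that {X_j : j ∈ I} is a basis of ℝ^n and the real span of {X_j : j ∈ I ∩ I_F} equals the real span of {X_j : j ∈ I_F}. Then N^F = Γ_{I∩I_F} · exp(𝔫^F): every element a ∈ N^F can be written (not necessarily uniquely) as a = g + [X] with g ∈ Γ_{I∩I_F} = N^F ∩ T^{I∩I_F} and X ∈ 𝔫^F = ker π ∩ ℝ^{I_F}, where [·] : ℝ^d → T^d is the quotient map. -/
noncomputable section

open scoped BigOperators

theorem map_coordSubspace_aux {n d : ℕ} (X : Fin d → (Fin n → ℝ))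
    (π : (Fin d → ℝ) →ₗ[ℝ] (Fin n → ℝ)) (hπ : ∀ j, π (Pi.single j 1) = X j)
    (S : Set (Fin d)) :
    Submodule.span ℝ (X '' S) = (coordSubspace S).map π := by
  apply le_antisymm
  · rw [Submodule.span_le]
    rintro _ ⟨j, hj, rfl⟩
    refine ⟨Pi.single j 1, ?_, hπ j⟩
    intro k hk
    have hne : k ≠ j := fun h => hk (h ▸ hj)
    simp [hne]
  · rintro _ ⟨v, hv, rfl⟩
    have hv' : ∀ j ∉ S, v j = 0 := hv
    rw [LinearMap.pi_apply_eq_sum_univ π v]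
    refine Submodule.sum_mem _ fun j _ => ?_
    by_cases hj : j ∈ S
    · have h1 : (fun k => if j = k then (1 : ℝ) else 0) = Pi.single j 1 := by
        ext k
        simp [Pi.single_apply, eq_comm]
      rw [h1, hπ]
      exact Submodule.smul_mem _ _ (Submodule.subset_span ⟨j, hj, rfl⟩)
    · simp [hv' j hj]

theorem mem_NGroup_aux {n d : ℕ} (π : (Fin d → ℝ) →ₗ[ℝ] (Fin n → ℝ))
    (Q : AddSubgroup (Fin n → ℝ))
    (hmap : intLattice d ≤ Q.comap π.toAddMonoidHom) (v : Fin d → ℝ) :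
    torusMk d v ∈ NGroup π Q hmap ↔ π v ∈ Q := by
  unfold NGroup torusMk
  rw [AddMonoidHom.mem_ker]
  exact QuotientAddGroup.eq_zero_iff (N := Q) (π v)

/-- If `{X_j : j ∈ I}` is a basis of `ℝ^n` and `span{X_j : j ∈ I ∩ I_F} = span{X_j : j ∈ I_F}`,
then `N^F = Γ_{I∩I_F} · exp(𝔫^F)`: every `a ∈ N^F` is `a = g + [X]` with
`g ∈ Γ_{I∩I_F} = N^F ∩ T^{I∩I_F}` and `X ∈ 𝔫^F = ker π ∩ ℝ^{I_F}`. -/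
theorem stmt9 {n d : ℕ} (hn : 1 ≤ n) (hd : n ≤ d)
    (X : Fin d → (Fin n → ℝ)) (hX : Submodule.span ℝ (Set.range X) = ⊤)
    (π : (Fin d → ℝ) →ₗ[ℝ] (Fin n → ℝ)) (hπ : ∀ j, π (Pi.single j 1) = X j)
    (Q : AddSubgroup (Fin n → ℝ)) (hQ : IsQuasilattice Q) (hXQ : ∀ j, X j ∈ Q)
    (hmap : intLattice d ≤ Q.comap π.toAddMonoidHom)
    (I IF : Set (Fin d))
    (hI1 : LinearIndependent ℝ (fun j : I => X j))
    (hI2 : Submodule.span ℝ (X '' I) = ⊤)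
    (hIF : Submodule.span ℝ (X '' (I ∩ IF)) = Submodule.span ℝ (X '' IF)) :
    ∀ a ∈ NGroup π Q hmap ⊓ subTorus IF,
      ∃ g ∈ (NGroup π Q hmap ⊓ subTorus IF) ⊓ subTorus (I ∩ IF),
        ∃ x ∈ LinearMap.ker π ⊓ coordSubspace IF, a = g + torusMk d x := by
  rintro a ⟨haN, v, hv, rfl⟩
  have hv1 : π v ∈ (coordSubspace (I ∩ IF)).map π := by
    rw [← map_coordSubspace_aux X π hπ, hIF, map_coordSubspace_aux X π hπ]
    exact ⟨v, hv, rfl⟩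
  obtain ⟨y, hy, hyv⟩ := hv1
  have hyF : y ∈ coordSubspace IF := fun j hj => hy j fun h => hj h.2
  have hN : π v ∈ Q := (mem_NGroup_aux π Q hmap v).1 haN
  refine ⟨torusMk d y, ⟨⟨(mem_NGroup_aux π Q hmap y).2 (hyv ▸ hN), y, hyF, rfl⟩, y, hy, rfl⟩,
    v - y, ⟨?_, Submodule.sub_mem _ hv hyF⟩, ?_⟩
  · simp [hyv]
  · rw [← map_add]
    congr 1
    abel

end
end

section
/- Let X_1, …, X_d be vectors spanning ℝ^n and let Q = Span_ℤ{X_1,…,X_d} be the quasilattice they generate. Then Q is a true lattice (i.e. a discrete subgroup of ℝ^n) if and only if the ℚ-vector space Span_ℚ{X_1,…,X_d} has dimension n over ℚ. -/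
noncomputable section

open scoped BigOperators

theorem exists_mul_mem_int_span {n : ℕ} (s : Set (Fin n → ℝ)) (x : Fin n → ℝ)
    (hx : x ∈ Submodule.span ℚ s) : ∃ N : ℤ, N ≠ 0 ∧ N • x ∈ Submodule.span ℤ s := by
  induction hx using Submodule.span_induction with
  | mem x h => exact ⟨1, one_ne_zero, by simpa using Submodule.subset_span h⟩
  | zero => exact ⟨1, one_ne_zero, by simp⟩
  | add x y _ _ hx hy =>
    obtain ⟨N, hN, hx⟩ := hx
    obtain ⟨M, hM, hy⟩ := hy
    refine ⟨M * N, mul_ne_zero hM hN, ?_⟩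
    rw [smul_add]
    refine add_mem ?_ ?_
    · rw [mul_smul]; exact Submodule.smul_mem _ _ hx
    · rw [mul_comm, mul_smul]; exact Submodule.smul_mem _ _ hy
  | smul a x _ hx =>
    obtain ⟨N, hN, hx⟩ := hx
    refine ⟨a.den * N, mul_ne_zero (by exact_mod_cast a.den_nz) hN, ?_⟩
    have : ((a.den : ℤ) * N) • (a • x) = a.num • (N • x) := by
      have h : (a.den : ℝ) * (a : ℝ) = a.num := by
        exact_mod_cast Rat.den_mul_eq_num a
      ext i
      simp only [Pi.smul_apply]
      simp only [zsmul_eq_mul, Rat.smul_def]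
      push_cast
      rw [← h]; ring
    rw [this]
    exact Submodule.smul_mem _ _ hx

theorem discrete_of_finrank {n d : ℕ}
    (X : Fin d → (Fin n → ℝ)) (hX : Submodule.span ℝ (Set.range X) = ⊤)
    (h : Module.finrank ℚ (Submodule.span ℚ (Set.range X)) = n) :
    DiscreteTopology (Submodule.span ℤ (Set.range X)) := by
  obtain ⟨s, hs, hspan, hli⟩ := exists_linearIndependent ℝ (Set.range X)
  have : Finite s := ((Set.finite_range X).subset hs).to_subtype
  have := Fintype.ofFinite s
  let b : Module.Basis s ℝ (Fin n → ℝ) := Module.Basis.mk hli (by simp [hspan, hX])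
  have hb : Set.range b = s := by simp [b]
  have hcard : Fintype.card s = n := by
    rw [← Module.finrank_eq_card_basis b]; simp
  have hliQ : LinearIndependent ℚ ((↑) : s → (Fin n → ℝ)) := hli.restrict_scalars' ℚ
  have hf := finrank_span_eq_card hliQ
  rw [Subtype.range_coe, hcard] at hf
  have : FiniteDimensional ℚ (Submodule.span ℚ (Set.range X)) :=
    FiniteDimensional.span_of_finite ℚ (Set.finite_range X)
  have heq : Submodule.span ℚ s = Submodule.span ℚ (Set.range X) :=
    Submodule.eq_of_le_of_finrank_eq (Submodule.span_mono hs) (hf.trans h.symm)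
  have hex : ∀ j, ∃ N : ℤ, N ≠ 0 ∧ N • X j ∈ Submodule.span ℤ s := fun j =>
    exists_mul_mem_int_span s (X j) (heq ▸ Submodule.subset_span ⟨j, rfl⟩)
  choose N hN hNX using hex
  let M : ℤ := ∏ j, N j
  have hM : M ≠ 0 := Finset.prod_ne_zero_iff.2 fun j _ => hN j
  have hmem : ∀ x ∈ Submodule.span ℤ (Set.range X),
      M • x ∈ Submodule.span ℤ (Set.range b) := by
    rw [hb]
    intro x hx
    induction hx using Submodule.span_induction with
    | mem x h =>
      obtain ⟨j, rfl⟩ := h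
      obtain ⟨c, hc⟩ := Finset.dvd_prod_of_mem N (Finset.mem_univ j)
      have : M = c * N j := by rw [mul_comm]; exact hc
      rw [this, mul_smul]
      exact Submodule.smul_mem _ _ (hNX j)
    | zero => simp
    | add x y _ _ hx hy => rw [smul_add]; exact add_mem hx hy
    | smul a x _ hx => rw [smul_comm]; exact Submodule.smul_mem _ _ hx
  let f : Submodule.span ℤ (Set.range X) → Submodule.span ℤ (Set.range b) :=
    fun x => ⟨M • (x : Fin n → ℝ), hmem x x.2⟩
  refine DiscreteTopology.of_continuous_injective (f := f) ?_ ?_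
  · exact Continuous.subtype_mk (continuous_subtype_val.const_smul M) _
  · intro x y hxy
    have h1 : M • (x : Fin n → ℝ) = M • (y : Fin n → ℝ) := congrArg Subtype.val hxy
    exact Subtype.ext (smul_right_injective _ hM h1)

theorem finrank_of_discrete {n d : ℕ}
    (X : Fin d → (Fin n → ℝ)) (hX : Submodule.span ℝ (Set.range X) = ⊤)
    (h : DiscreteTopology (Submodule.span ℤ (Set.range X))) :
    Module.finrank ℚ (Submodule.span ℚ (Set.range X)) = n := by
  have : IsZLattice ℝ (Submodule.span ℤ (Set.range X)) :=
    ⟨by rw [Submodule.span_span_of_tower, hX]⟩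
  let b := Module.Free.chooseBasis ℤ (Submodule.span ℤ (Set.range X))
  let B := b.ofZLatticeBasis ℝ
  have hB : Submodule.span ℤ (Set.range B) = Submodule.span ℤ (Set.range X) :=
    b.ofZLatticeBasis_span ℝ
  have hBQ : Submodule.span ℚ (Set.range B) = Submodule.span ℚ (Set.range X) := by
    rw [← Submodule.span_span_of_tower ℤ ℚ (Set.range B), hB, Submodule.span_span_of_tower]
  rw [← hBQ, finrank_span_eq_card (B.linearIndependent.restrict_scalars' ℚ),
    ← Module.finrank_eq_card_basis B]
  simp

/-- The quasilattice `Q = Span_ℤ{X_1,…,X_d}` is a true lattice (discrete in `ℝ^n`) iff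
`Span_ℚ{X_1,…,X_d}` has dimension `n` over `ℚ`. -/
theorem stmt12 {n d : ℕ} (hn : 1 ≤ n) (hd : n ≤ d)
    (X : Fin d → (Fin n → ℝ)) (hX : Submodule.span ℝ (Set.range X) = ⊤) :
    DiscreteTopology (AddSubgroup.closure (Set.range X) : AddSubgroup (Fin n → ℝ)) ↔
      Module.finrank ℚ (Submodule.span ℚ (Set.range X)) = n := by
  rw [← Submodule.span_int_eq_addSubgroupClosure]
  exact ⟨fun h => finrank_of_discrete X hX h, fun h => discrete_of_finrank X hX h⟩

end
end

section
/- Let I ⊆ {1,…,d} with {X_j : j ∈ I} a basis of ℝ^n, and let I_F ⊆ {1,…,d}. Write J = I ∩ I_F and K = I ∖ J, so T^I = T^J × T^K, and let Γ̌^I_J and Γ̌_K denote the images of Γ_I under the two coordinate projections T^I → T^J and T^I → T^K. Set Γ_J := N ∩ T^J and Γ_K := N ∩ T^K. Then there is a well-defined surjective group homomorphism ℓ : Γ̌_K → Γ̌^I_J / Γ_J sending g₂ ∈ Γ̌_K to the class [g₁] of any g₁ ∈ T^J with (g₁, g₂) ∈ Γ_I, and the kernel of ℓ is Γ_K; i.e.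 the sequence 1 → Γ_K → Γ̌_K → Γ̌^I_J/Γ_J → 1 is exact. -/
noncomputable section

open scoped BigOperators

/-- The coordinate projection `ℝ^d → ℝ^I ⊆ ℝ^d`, as an additive homomorphism. -/
def projAdd {d : ℕ} (I : Set (Fin d)) : (Fin d → ℝ) →+ (Fin d → ℝ) where
  toFun x := I.indicator x
  map_zero' := by
    funext j
    simp
  map_add' x y := by
    funext j
    classical
    by_cases hj : j ∈ I <;> simp [Set.indicator_apply, hj]

/-- The projection `T^d → T^I ⊆ T^d` induced by the coordinate projection. -/
def projTorus {d : ℕ} (I : Set (Fin d)) : Torus d →+ Torus d :=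
  QuotientAddGroup.map (intLattice d) (intLattice d) (projAdd I) (by
    intro x hx
    show projAdd I x ∈ intLattice d
    intro j
    classical
    by_cases hj : j ∈ I
    · obtain ⟨m, hm⟩ := hx j
      exact ⟨m, by simpa [projAdd, Set.indicator_apply, hj] using hm⟩
    · exact ⟨0, by simp [projAdd, Set.indicator_apply, hj]⟩)

lemma exact_aux {G : Type*} [AddCommGroup G] (N TI TJ TK : AddSubgroup G) (p q : G →+ G)
    (hsum : ∀ x ∈ TI, p x + q x = x) (hpJ : ∀ x, p x ∈ TJ) (hqK : ∀ x, q x ∈ TK)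
    (hpi : ∀ x ∈ TJ, p x = x) (hqz : ∀ x ∈ TJ, q x = 0)
    (hqi : ∀ x ∈ TK, q x = x) (hpz : ∀ x ∈ TK, p x = 0) :
    ∃ ℓ : ↥(AddSubgroup.map q (N ⊓ TI)) →+
          (↥(AddSubgroup.map p (N ⊓ TI)) ⧸
            ((N ⊓ TJ).addSubgroupOf (AddSubgroup.map p (N ⊓ TI)))),
      Function.Surjective ℓ ∧
      (∀ (g₁ : ↥(AddSubgroup.map p (N ⊓ TI))) (g₂ : ↥(AddSubgroup.map q (N ⊓ TI))),
        (g₁ : G) + (g₂ : G) ∈ N ⊓ TI → ℓ g₂ = QuotientAddGroup.mk g₁) ∧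
      ℓ.ker = (N ⊓ TK).addSubgroupOf (AddSubgroup.map q (N ⊓ TI)) := by
  have hex : ∀ g : ↥(AddSubgroup.map q (N ⊓ TI)), ∃ x, x ∈ N ⊓ TI ∧ q x = g := fun g => g.2
  choose c hc hqc using hex
  -- well-definedness
  have key : ∀ x ∈ N ⊓ TI, ∀ y ∈ N ⊓ TI, q x = q y → p x - p y ∈ N ⊓ TJ := by
    intro x hx y hy h
    refine ⟨?_, TJ.sub_mem (hpJ x) (hpJ y)⟩
    have h1 := hsum x hx.2
    have h2 := hsum y hy.2
    have : p x - p y = x - y := by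
      calc p x - p y = (p x + q x) - (p y + q y) := by rw [h]; abel
        _ = x - y := by rw [h1, h2]
    rw [this]
    exact N.sub_mem hx.1 hy.1
  let f : ↥(AddSubgroup.map q (N ⊓ TI)) →
      (↥(AddSubgroup.map p (N ⊓ TI)) ⧸
            ((N ⊓ TJ).addSubgroupOf (AddSubgroup.map p (N ⊓ TI)))) := fun g =>
    QuotientAddGroup.mk ⟨p (c g), AddSubgroup.mem_map_of_mem p (hc g)⟩
  have hf : ∀ (g : ↥(AddSubgroup.map q (N ⊓ TI))) (x : G) (hx : x ∈ N ⊓ TI), q x = g →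
      f g = QuotientAddGroup.mk ⟨p x, AddSubgroup.mem_map_of_mem p hx⟩ := by
    intro g x hx h
    refine (QuotientAddGroup.eq).2 ?_
    rw [AddSubgroup.mem_addSubgroupOf]
    have := key x hx (c g) (hc g) (h.trans (hqc g).symm)
    simpa [sub_eq_neg_add] using this
  refine ⟨AddMonoidHom.mk' f ?_, ?_, ?_, ?_⟩
  · intro a b
    rw [hf (a + b) (c a + c b) (add_mem (hc a) (hc b)) (by simp [hqc])]
    rw [← QuotientAddGroup.mk_add]
    congr 1
    ext
    simp
  · intro y
    obtain ⟨⟨_, x, hx, rfl⟩, rfl⟩ := QuotientAddGroup.mk_surjective y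
    exact ⟨⟨q x, AddSubgroup.mem_map_of_mem q hx⟩, hf _ x hx rfl⟩
  · intro g₁ g₂ h
    have m1 : (g₁ : G) ∈ TJ := by obtain ⟨x, _, e⟩ := g₁.2; rw [← e]; exact hpJ x
    have m2 : (g₂ : G) ∈ TK := by obtain ⟨x, _, e⟩ := g₂.2; rw [← e]; exact hqK x
    refine (hf g₂ _ h (by rw [map_add, hqz _ m1, hqi _ m2, zero_add])).trans ?_
    congr 1
    ext
    simp [hpi _ m1, hpz _ m2]
  · ext g
    have h1 := hsum _ (hc g).2
    rw [hqc] at h1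
    have hK : (g : G) ∈ TK := by rw [← hqc g]; exact hqK _
    rw [AddMonoidHom.mem_ker, AddSubgroup.mem_addSubgroupOf]
    change f g = 0 ↔ _
    rw [QuotientAddGroup.eq_zero_iff, AddSubgroup.mem_addSubgroupOf]
    constructor
    · intro h
      refine ⟨?_, hK⟩
      have : (g : G) = c g - p (c g) := eq_sub_of_add_eq' h1
      rw [this]
      exact N.sub_mem (hc g).1 h.1
    · intro h
      refine ⟨?_, hpJ _⟩
      have : p (c g) = c g - g := eq_sub_of_add_eq h1
      change p (c g) ∈ N
      rw [this]
      exact N.sub_mem (hc g).1 h.1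

lemma projTorus_torusMk {d : ℕ} (A : Set (Fin d)) (x : Fin d → ℝ) :
    projTorus A (torusMk d x) = torusMk d (A.indicator x) := rfl

lemma projTorus_mem {d : ℕ} (A : Set (Fin d)) (x : Torus d) : projTorus A x ∈ subTorus A := by
  obtain ⟨y, rfl⟩ := QuotientAddGroup.mk_surjective x
  refine ⟨A.indicator y, ?_, rfl⟩
  intro j hj
  simp [hj]

lemma projTorus_id {d : ℕ} (A : Set (Fin d)) (x : Torus d) (hx : x ∈ subTorus A) :
    projTorus A x = x := by
  obtain ⟨y, hy, rfl⟩ := hx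
  rw [projTorus_torusMk]
  congr 1
  funext j
  by_cases hj : j ∈ A
  · simp [hj]
  · simp [hj, hy j hj]

lemma projTorus_zero {d : ℕ} (A B : Set (Fin d)) (hAB : Disjoint A B) (x : Torus d)
    (hx : x ∈ subTorus B) : projTorus A x = 0 := by
  obtain ⟨y, hy, rfl⟩ := hx
  rw [projTorus_torusMk, ← map_zero (torusMk d)]
  congr 1
  funext j
  by_cases hj : j ∈ A
  · simp [hj, hy j (Set.disjoint_left.1 hAB hj)]
  · simp [hj]

lemma projTorus_sum {d : ℕ} (A B : Set (Fin d)) (x : Torus d) (hx : x ∈ subTorus A) :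
    projTorus (A ∩ B) x + projTorus (A \ (A ∩ B)) x = x := by
  obtain ⟨y, hy, rfl⟩ := hx
  rw [projTorus_torusMk, projTorus_torusMk, ← map_add]
  congr 1
  funext j
  by_cases hj : j ∈ A
  · by_cases hB : j ∈ B <;> simp [hj, hB]
  · simp [hj, hy j hj]

/-- With `J = I ∩ I_F`, `K = I ∖ J`, and `Γ̌^I_J`, `Γ̌_K` the images of `Γ_I` under the two
coordinate projections of `T^I = T^J × T^K`, there is a well-defined surjective homomorphism
`ℓ : Γ̌_K → Γ̌^I_J/Γ_J` sending `g₂` to the class of any `g₁` with `(g₁, g₂) ∈ Γ_I`, and its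
kernel is `Γ_K`; i.e. `1 → Γ_K → Γ̌_K → Γ̌^I_J/Γ_J → 1` is exact. -/
theorem stmt14 {n d : ℕ} (hn : 1 ≤ n) (hd : n ≤ d)
    (X : Fin d → (Fin n → ℝ)) (hX : Submodule.span ℝ (Set.range X) = ⊤)
    (π : (Fin d → ℝ) →ₗ[ℝ] (Fin n → ℝ)) (hπ : ∀ j, π (Pi.single j 1) = X j)
    (Q : AddSubgroup (Fin n → ℝ)) (hQ : IsQuasilattice Q) (hXQ : ∀ j, X j ∈ Q)
    (hmap : intLattice d ≤ Q.comap π.toAddMonoidHom)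
    (I IF : Set (Fin d))
    (hI1 : LinearIndependent ℝ (fun j : I => X j))
    (hI2 : Submodule.span ℝ (X '' I) = ⊤) :
    ∃ ℓ : ↥(AddSubgroup.map (projTorus (I \ (I ∩ IF)))
            (NGroup π Q hmap ⊓ subTorus I)) →+
          (↥(AddSubgroup.map (projTorus (I ∩ IF)) (NGroup π Q hmap ⊓ subTorus I)) ⧸
            ((NGroup π Q hmap ⊓ subTorus (I ∩ IF)).addSubgroupOf
              (AddSubgroup.map (projTorus (I ∩ IF)) (NGroup π Q hmap ⊓ subTorus I)))),
      Function.Surjective ℓ ∧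
      (∀ (g₁ : ↥(AddSubgroup.map (projTorus (I ∩ IF)) (NGroup π Q hmap ⊓ subTorus I)))
         (g₂ : ↥(AddSubgroup.map (projTorus (I \ (I ∩ IF)))
            (NGroup π Q hmap ⊓ subTorus I))),
        (g₁ : Torus d) + (g₂ : Torus d) ∈ NGroup π Q hmap ⊓ subTorus I →
        ℓ g₂ = QuotientAddGroup.mk g₁) ∧
      ℓ.ker = (NGroup π Q hmap ⊓ subTorus (I \ (I ∩ IF))).addSubgroupOf
        (AddSubgroup.map (projTorus (I \ (I ∩ IF))) (NGroup π Q hmap ⊓ subTorus I)) := by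
  have hdis : Disjoint (I ∩ IF) (I \ (I ∩ IF)) := disjoint_sdiff_self_right
  exact exact_aux (NGroup π Q hmap) (subTorus I) (subTorus (I ∩ IF)) (subTorus (I \ (I ∩ IF)))
    (projTorus (I ∩ IF)) (projTorus (I \ (I ∩ IF))) (projTorus_sum I IF) (projTorus_mem _)
    (projTorus_mem _) (projTorus_id _) (projTorus_zero _ _ hdis.symm) (projTorus_id _)
    (projTorus_zero _ _ hdis)

end
end

section
/- Let I ⊆ {1,…,d} with {X_j : j ∈ I} a basis of ℝ^n, and let I_F ⊆ {1,…,d} be such that the real span of {X_j : j ∈ I ∩ I_F} equals the real span of {X_j : j ∈ I_F}. Then N ∩ T^{I ∪ I_F} = Γ_I + N^F, i.e. every element of N lying in T^{I ∪ I_F} is a product of an element of Γ_I = N ∩ T^I and an element of N^F = N ∩ T^{I_F}. -/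
noncomputable section

open scoped BigOperators

theorem mem_NGroup_mk {n d : ℕ} (π : (Fin d → ℝ) →ₗ[ℝ] (Fin n → ℝ))
    (Q : AddSubgroup (Fin n → ℝ)) (hmap : intLattice d ≤ Q.comap π.toAddMonoidHom)
    (x : Fin d → ℝ) : torusMk d x ∈ NGroup π Q hmap ↔ π x ∈ Q := by
  unfold NGroup torusMk
  rw [AddMonoidHom.mem_ker]
  exact QuotientAddGroup.eq_zero_iff (π x)

theorem map_coordSubspace {n d : ℕ} (X : Fin d → (Fin n → ℝ))
    (π : (Fin d → ℝ) →ₗ[ℝ] (Fin n → ℝ)) (hπ : ∀ j, π (Pi.single j 1) = X j)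
    (J : Set (Fin d)) : (coordSubspace J).map π = Submodule.span ℝ (X '' J) := by
  apply le_antisymm
  · rintro _ ⟨w, hw, rfl⟩
    have hw' : ∀ j ∉ J, w j = 0 := hw
    rw [LinearMap.pi_apply_eq_sum_univ π w]
    refine Submodule.sum_mem _ fun j _ => ?_
    by_cases hj : j ∈ J
    · refine Submodule.smul_mem _ _ (Submodule.subset_span ⟨j, hj, ?_⟩)
      rw [← hπ j]
      congr 1
      ext k
      simp [Pi.single_apply, eq_comm]
    · rw [hw' j hj, zero_smul]
      exact Submodule.zero_mem _
  · rw [Submodule.span_le]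
    rintro _ ⟨j, hj, rfl⟩
    refine ⟨Pi.single j 1, ?_, hπ j⟩
    intro k hk
    have hkj : k ≠ j := fun h => hk (by rw [h]; exact hj)
    simp [hkj]

/-- If `{X_j : j ∈ I}` is a basis of `ℝ^n` and `span{X_j : j ∈ I ∩ I_F} = span{X_j : j ∈ I_F}`,
then `N ∩ T^{I ∪ I_F} = Γ_I + N^F`. -/
theorem stmt15 {n d : ℕ} (hn : 1 ≤ n) (hd : n ≤ d)
    (X : Fin d → (Fin n → ℝ)) (hX : Submodule.span ℝ (Set.range X) = ⊤)
    (π : (Fin d → ℝ) →ₗ[ℝ] (Fin n → ℝ)) (hπ : ∀ j, π (Pi.single j 1) = X j)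
    (Q : AddSubgroup (Fin n → ℝ)) (hQ : IsQuasilattice Q) (hXQ : ∀ j, X j ∈ Q)
    (hmap : intLattice d ≤ Q.comap π.toAddMonoidHom)
    (I IF : Set (Fin d))
    (hI1 : LinearIndependent ℝ (fun j : I => X j))
    (hI2 : Submodule.span ℝ (X '' I) = ⊤)
    (hIF : Submodule.span ℝ (X '' (I ∩ IF)) = Submodule.span ℝ (X '' IF)) :
    ∀ a : Torus d, a ∈ NGroup π Q hmap ⊓ subTorus (I ∪ IF) ↔
      ∃ g ∈ NGroup π Q hmap ⊓ subTorus I,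
        ∃ b ∈ NGroup π Q hmap ⊓ subTorus IF, a = g + b := by
  intro a
  constructor
  · rintro ⟨haN, x, hx, rfl⟩
    have hx' : ∀ j ∉ I ∪ IF, x j = 0 := hx
    have hQx : π x ∈ Q := (mem_NGroup_mk π Q hmap x).1 haN
    classical
    set w : Fin d → ℝ := fun j => if j ∈ IF then x j else 0 with hwdef
    have hw : w ∈ coordSubspace IF := by
      intro j hj
      simp [hwdef, hj]
    have hπw : π w ∈ (coordSubspace (I ∩ IF)).map π := by
      rw [map_coordSubspace X π hπ, hIF, ← map_coordSubspace X π hπ]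
      exact ⟨w, hw, rfl⟩
    obtain ⟨v, hv, hvw⟩ := hπw
    have hv' : ∀ j ∉ I ∩ IF, v j = 0 := hv
    refine ⟨torusMk d (x - w + v), ⟨?_, x - w + v, ?_, rfl⟩,
      torusMk d (w - v), ⟨?_, w - v, ?_, rfl⟩, ?_⟩
    · refine (mem_NGroup_mk π Q hmap _).2 ?_
      rw [map_add, map_sub, hvw, sub_add_cancel]
      exact hQx
    · intro j hj
      have h1 : v j = 0 := hv' j fun h => hj h.1
      by_cases hjF : j ∈ IF
      · simp [hwdef, hjF, h1]
      · have h2 : x j = 0 := hx' j fun h => h.elim hj hjF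
        simp [hwdef, hjF, h1, h2]
    · refine (mem_NGroup_mk π Q hmap _).2 ?_
      rw [map_sub, hvw, sub_self]
      exact Q.zero_mem
    · intro j hj
      have h1 : v j = 0 := hv' j fun h => hj h.2
      simp [hwdef, hj, h1]
    · rw [← map_add]
      congr 1
      abel
  · rintro ⟨g, ⟨hgN, x, hx, rfl⟩, b, ⟨hbN, y, hy, rfl⟩, rfl⟩
    refine ⟨add_mem hgN hbN, x + y, ?_, map_add _ _ _⟩
    intro j hj
    have h1 : x j = 0 := hx j fun h => hj (Or.inl h)
    have h2 : y j = 0 := hy j fun h => hj (Or.inr h)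
    simp [h1, h2]

end
end

section
/- Suppose I ⊆ {1,…,d} is such that {X_j : j ∈ I} is a basis of ℝ^n. Then for every z ∈ ℂ^d with z_j ≠ 0 for all j ∉ I, there exists a ∈ N such that the element a·z has (a·z)_j ∈ ℝ_{>0} for every j ∉ I; i.e. every such point can be moved by N so that all its coordinates outside I become positive real numbers. -/
noncomputable section

open scoped BigOperators

/-- If `{X_j : j ∈ I}` is a basis of `ℝ^n`, every `z ∈ ℂ^d` with all coordinates outside `I`
nonzero can be moved by an element of `N` so that all its coordinates outside `I` become
positive real numbers. -/
theorem stmt16 {n d : ℕ} (hn : 1 ≤ n) (hd : n ≤ d)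
    (X : Fin d → (Fin n → ℝ)) (hX : Submodule.span ℝ (Set.range X) = ⊤)
    (π : (Fin d → ℝ) →ₗ[ℝ] (Fin n → ℝ)) (hπ : ∀ j, π (Pi.single j 1) = X j)
    (Q : AddSubgroup (Fin n → ℝ)) (hQ : IsQuasilattice Q) (hXQ : ∀ j, X j ∈ Q)
    (hmap : intLattice d ≤ Q.comap π.toAddMonoidHom)
    (I : Set (Fin d))
    (hI1 : LinearIndependent ℝ (fun j : I => X j))
    (hI2 : Submodule.span ℝ (X '' I) = ⊤) :
    ∀ z : Fin d → ℂ, (∀ j ∉ I, z j ≠ 0) →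
      ∃ θ : Fin d → ℝ, torusMk d θ ∈ NGroup π Q hmap ∧
        ∀ j ∉ I, ∃ r : ℝ, 0 < r ∧ rotate θ z j = (r : ℂ) := by
  intro z hz
  set φ : Fin d → ℝ := fun j => -(z j).arg / (2 * Real.pi) with hφ
  have key : ∀ v : Fin n → ℝ, v ∈ Submodule.span ℝ (X '' I) →
      v ∈ (coordSubspace I).map π := by
    intro v hv
    refine (Submodule.span_le.2 ?_) hv
    rintro _ ⟨j, hj, rfl⟩
    refine ⟨Pi.single j 1, ?_, hπ j⟩
    intro k hk
    have hkj : k ≠ j := fun h => hk (h ▸ hj)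
    simp [hkj]
  obtain ⟨w, hw, hwφ⟩ := key (π φ) (by rw [hI2]; trivial)
  refine ⟨φ - w, ?_, ?_⟩
  · have h0 : π (φ - w) = 0 := by rw [map_sub, hwφ, sub_self]
    change QuotientAddGroup.map (intLattice d) Q π.toAddMonoidHom hmap
      (QuotientAddGroup.mk (φ - w)) = 0
    rw [QuotientAddGroup.map_mk]
    change ((π (φ - w) : Fin n → ℝ) : (Fin n → ℝ) ⧸ Q) = 0
    rw [h0]
    rfl
  · intro j hj
    refine ⟨‖z j‖, norm_pos_iff.2 (hz j hj), ?_⟩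
    have hwj : w j = 0 := hw j hj
    have h1 : 2 * Real.pi * (φ - w) j = -(z j).arg := by
      have := Real.pi_ne_zero
      simp only [Pi.sub_apply, hwj, hφ]
      field_simp
      ring
    unfold rotate
    rw [h1]
    have h2 := Complex.norm_mul_exp_arg_mul_I (z j)
    calc _ = Complex.exp (((-(z j).arg : ℝ) : ℂ) * Complex.I) *
          ((‖z j‖ : ℂ) * Complex.exp ((z j).arg * Complex.I)) := by rw [h2]
      _ = (‖z j‖ : ℂ) * (Complex.exp (((-(z j).arg : ℝ) : ℂ) * Complex.I) *
          Complex.exp ((z j).arg * Complex.I)) := by ring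
      _ = _ := by rw [← Complex.exp_add]; simp

end
end

section
/- Let μ ∈ (ℝ^n)^* with ⟨μ, X_j⟩ ≥ λ_j for all j, set I_μ := {j : ⟨μ, X_j⟩ = λ_j}, and assume {X_j : j ∈ I_μ} spans ℝ^n (μ is a vertex of Δ). If z, z′ ∈ Z both satisfy {j : z_j = 0} = {j : z′_j = 0} = I_μ, then there exists a ∈ N with a·z = z′; i.e. N acts transitively on the fiber of the vertex μ, so the corresponding stratum of the quotient is a single point. -/
noncomputable section

open scoped BigOperators

/-- If `μ` is a vertex of `Δ` (i.e. `{X_j : j ∈ I_μ}` spans `ℝ^n` where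
`I_μ = {j : ⟨μ, X_j⟩ = λ_j}`), then `N` acts transitively on the set of points of `Z`
whose zero coordinate set is exactly `I_μ`. -/
theorem stmt17 {n d : ℕ} (hn : 1 ≤ n) (hd : n ≤ d)
    (X : Fin d → (Fin n → ℝ)) (hX : Submodule.span ℝ (Set.range X) = ⊤)
    (lam : Fin d → ℝ)
    (π : (Fin d → ℝ) →ₗ[ℝ] (Fin n → ℝ)) (hπ : ∀ j, π (Pi.single j 1) = X j)
    (Q : AddSubgroup (Fin n → ℝ)) (hQ : IsQuasilattice Q) (hXQ : ∀ j, X j ∈ Q)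
    (hmap : intLattice d ≤ Q.comap π.toAddMonoidHom)
    (μ : Fin n → ℝ) (hμ : μ ∈ DeltaSet X lam)
    (hvertex : Submodule.span ℝ (X '' {j | pairR μ (X j) = lam j}) = ⊤)
    (z z' : Fin d → ℂ) (hz : z ∈ ZSet π lam) (hz' : z' ∈ ZSet π lam)
    (h1 : {j | z j = 0} = {j | pairR μ (X j) = lam j})
    (h2 : {j | z' j = 0} = {j | pairR μ (X j) = lam j}) :
    ∃ θ : Fin d → ℝ, torusMk d θ ∈ NGroup π Q hmap ∧ rotate θ z = z' := by
  set I : Set (Fin d) := {j | pairR μ (X j) = lam j} with hI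
  have key : ∀ v : Fin n → ℝ, ∃ c : Fin d → ℝ, (∀ j, j ∉ I → c j = 0) ∧ π c = v := by
    intro v
    have hle : Submodule.span ℝ (X '' I) ≤ (coordSubspace I).map π := by
      rw [Submodule.span_le]
      rintro _ ⟨j, hj, rfl⟩
      refine ⟨Pi.single j 1, ?_, hπ j⟩
      intro k hk
      have hkj : k ≠ j := by
        rintro rfl
        exact hk hj
      simp [hkj]
    have hv : v ∈ (coordSubspace I).map π := hle (by rw [hvertex]; trivial)
    obtain ⟨c, hc, hcv⟩ := hv
    exact ⟨c, hc, hcv⟩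
  have hz0 : ∀ j, j ∈ I ↔ z j = 0 := fun j => by rw [← h1]; rfl
  have hz0' : ∀ j, j ∈ I ↔ z' j = 0 := fun j => by rw [← h2]; rfl
  have hnorm : ∀ j, ‖z j‖ = ‖z' j‖ := by
    intro j
    by_cases hj : j ∈ I
    · rw [(hz0 j).1 hj, (hz0' j).1 hj]
    · obtain ⟨c, hc, hcv⟩ := key (X j)
      have hker : Pi.single j 1 - c ∈ LinearMap.ker π := by
        rw [LinearMap.mem_ker, map_sub, hπ, hcv, sub_self]
      have e1 := hz _ hker
      have e2 := hz' _ hker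
      have e3 : ∑ k, (‖z k‖ ^ 2 - ‖z' k‖ ^ 2) * ((Pi.single j 1 - c : Fin d → ℝ) k) = 0 := by
        have : pairR (UpsilonV lam z) (Pi.single j 1 - c)
            - pairR (UpsilonV lam z') (Pi.single j 1 - c) = 0 := by rw [e1, e2, sub_self]
        rw [← this]
        unfold pairR UpsilonV
        rw [← Finset.sum_sub_distrib]
        exact Finset.sum_congr rfl fun k _ => by ring
      rw [Finset.sum_eq_single j] at e3
      · have hsq : ‖z j‖ ^ 2 = ‖z' j‖ ^ 2 := by
          simp [hc j hj] at e3
          linarith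
        exact (sq_eq_sq₀ (norm_nonneg _) (norm_nonneg _)).1 hsq
      · intro k _ hkj
        by_cases hk : k ∈ I
        · simp [(hz0 k).1 hk, (hz0' k).1 hk]
        · simp [hkj, hc k hk]
      · intro h
        exact absurd (Finset.mem_univ j) h
  let t : Fin d → ℝ := fun j => (Complex.arg (z' j) - Complex.arg (z j)) / (2 * Real.pi)
  obtain ⟨c, hc, hct⟩ := key (π t)
  refine ⟨t - c, ?_, ?_⟩
  · have h0 : π (t - c) = 0 := by rw [map_sub, hct, sub_self]
    change ((π (t - c) : Fin n → ℝ) : (Fin n → ℝ) ⧸ Q) = 0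
    rw [h0]
    rfl
  · funext j
    unfold rotate
    by_cases hj : j ∈ I
    · rw [(hz0 j).1 hj, (hz0' j).1 hj, mul_zero]
    · have h2t : 2 * Real.pi * (t - c) j = Complex.arg (z' j) - Complex.arg (z j) := by
        have : (2 * Real.pi) ≠ 0 := by positivity
        simp only [Pi.sub_apply, hc j hj, sub_zero, t]
        field_simp
      rw [h2t]
      have p := Complex.norm_mul_exp_arg_mul_I (z j)
      have p' := Complex.norm_mul_exp_arg_mul_I (z' j)
      refine (congrArg (fun w => Complex.exp
        (((Complex.arg (z' j) - Complex.arg (z j) : ℝ) : ℂ) * Complex.I) * w) p.symm).trans ?_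
      refine Eq.trans ?_ p'
      rw [hnorm j, mul_left_comm, ← Complex.exp_add]
      congr 2
      push_cast
      ring

end
end

section
/- Assume there exists μ ∈ (ℝ^n)^* with ⟨μ, X_j⟩ > λ_j for all j (the polytope Δ has nonempty interior). If t ∈ T^d is such that for every z ∈ Z there exists a ∈ N with t·z = a·z, then t ∈ N; consequently the induced action of the quasitorus D = T^d/N ≅ ℝ^n/Q on the quotient M = Z/N is effective. -/
noncomputable section

open scoped BigOperators

/-- If `Δ` has nonempty interior and `t ∈ T^d` moves every point of `Z` the same way as some
element of `N` does, then `t ∈ N`; hence the quasitorus `D = T^d/N` acts effectively on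
`M = Z/N`. -/
theorem stmt18 {n d : ℕ} (hn : 1 ≤ n) (hd : n ≤ d)
    (X : Fin d → (Fin n → ℝ)) (hX : Submodule.span ℝ (Set.range X) = ⊤)
    (lam : Fin d → ℝ)
    (π : (Fin d → ℝ) →ₗ[ℝ] (Fin n → ℝ)) (hπ : ∀ j, π (Pi.single j 1) = X j)
    (Q : AddSubgroup (Fin n → ℝ)) (hQ : IsQuasilattice Q) (hXQ : ∀ j, X j ∈ Q)
    (hmap : intLattice d ≤ Q.comap π.toAddMonoidHom)
    (hint : ∃ μ : Fin n → ℝ, ∀ j, lam j < pairR μ (X j))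
    (φ : Fin d → ℝ)
    (h : ∀ z ∈ ZSet π lam, ∃ θ : Fin d → ℝ, torusMk d θ ∈ NGroup π Q hmap ∧
      rotate φ z = rotate θ z) :
    torusMk d φ ∈ NGroup π Q hmap := by
  obtain ⟨μ, hμ⟩ := hint
  have hpi : ∀ x : Fin d → ℝ, π x = ∑ j, x j • X j := by
    intro x
    conv_lhs => rw [pi_eq_sum_univ' x]
    rw [map_sum]
    refine Finset.sum_congr rfl fun j _ => ?_
    rw [map_smul, ← hπ j]
  set z : Fin d → ℂ := fun j => ((Real.sqrt (pairR μ (X j) - lam j) : ℝ) : ℂ) with hz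
  have hU : ∀ j, UpsilonV lam z j = pairR μ (X j) := by
    intro j
    simp only [UpsilonV, hz, Complex.norm_real, Real.norm_eq_abs, sq_abs]
    rw [Real.sq_sqrt (by linarith [hμ j])]
    ring
  have hzZ : z ∈ ZSet π lam := by
    intro x hx
    have hx0 : ∑ j, x j • X j = 0 := by rw [← hpi]; exact hx
    have h1 : pairR (UpsilonV lam z) x = ∑ i, μ i * (∑ j, x j • X j) i := by
      simp only [pairR, hU, Finset.sum_apply, Pi.smul_apply, smul_eq_mul, Finset.mul_sum,
        Finset.sum_mul]
      rw [Finset.sum_comm]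
      refine Finset.sum_congr rfl fun i _ => Finset.sum_congr rfl fun j _ => by ring
    rw [h1, hx0]
    simp
  obtain ⟨θ, hθ, heq⟩ := h z hzZ
  have hkey : torusMk d θ = torusMk d φ := by
    refine QuotientAddGroup.eq.mpr ?_
    intro j
    have hj := congrFun heq j
    have hz0 : z j ≠ 0 := by
      have : 0 < Real.sqrt (pairR μ (X j) - lam j) := Real.sqrt_pos.mpr (by linarith [hμ j])
      exact Complex.ofReal_ne_zero.mpr this.ne'
    have he := mul_right_cancel₀ hz0 hj
    obtain ⟨m, hm⟩ := Complex.exp_eq_exp_iff_exists_int.mp he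
    refine ⟨m, ?_⟩
    have hI := congrArg Complex.im hm
    simp at hI
    have hp := Real.pi_pos
    have : φ j = θ j + m := by
      have h2 : (2 * Real.pi) * φ j = (2 * Real.pi) * (θ j + m) := by linarith
      exact mul_left_cancel₀ (by positivity) h2
    simp [this]
  rw [← hkey]
  exact hθ

end
end

section
/- Suppose I ⊆ {1,…,d} is such that {X_j : j ∈ I} is a basis of ℝ^n. For u ∈ ℂ^I (identified with {z ∈ ℂ^d : z_j = 0 for j ∉ I}) let μ_u ∈ (ℝ^n)^* be the unique functional with ⟨μ_u, X_h⟩ = |u_h|² + λ_h for all h ∈ I; set Ũ_I := {u ∈ ℂ^I : ⟨μ_u, X_j⟩ − λ_j > 0 for all j ∉ I}, and define the slice map φ̃_I : Ũ_I → ℂ^d by (φ̃_I(u))_h = u_h for h ∈ I and (φ̃_I(u))_j = √(⟨μ_u, X_j⟩ − λ_j) for j ∉ I. Then φ̃_I(Ũ_I) ⊆ Z, and for every subset C ⊆ Ũ_I that is closed in the subspace topology of Ũ_I and invariant under the coordinatewise rotation action of Γ_I on ℂ^I, the saturation N·φ̃_I(C) = {a·φ̃_I(u) : a ∈ N, u ∈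 C} is a closed subset of Û_I := Z ∩ {z ∈ ℂ^d : z_j ≠ 0 for all j ∉ I}. -/
noncomputable section

open scoped BigOperators

/-! ### Auxiliary facts for the proof -/

lemma aux_pair {n d : ℕ} (X : Fin d → (Fin n → ℝ))
    (π : (Fin d → ℝ) →ₗ[ℝ] (Fin n → ℝ)) (hπ : ∀ j, π (Pi.single j 1) = X j)
    (μ : Fin n → ℝ) (x : Fin d → ℝ) : pairR μ (π x) = pairR (piStar X μ) x := by
  have hx : π x = ∑ j, x j • X j := by
    conv_lhs => rw [pi_eq_sum_univ' x]
    rw [map_sum]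
    refine Finset.sum_congr rfl fun j _ => ?_
    rw [map_smul, ← hπ j]
  rw [hx]
  simp only [pairR, piStar, Finset.sum_apply, Pi.smul_apply, smul_eq_mul, Finset.mul_sum,
    Finset.sum_mul]
  rw [Finset.sum_comm]
  refine Finset.sum_congr rfl fun j _ => Finset.sum_congr rfl fun i _ => ?_
  ring

lemma aux_section {n d : ℕ} (X : Fin d → (Fin n → ℝ))
    (π : (Fin d → ℝ) →ₗ[ℝ] (Fin n → ℝ)) (hπ : ∀ j, π (Pi.single j 1) = X j)
    (I : Set (Fin d)) (hI2 : Submodule.span ℝ (X '' I) = ⊤) :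
    ∃ σ : (Fin n → ℝ) →ₗ[ℝ] (Fin d → ℝ), (∀ y, π (σ y) = y) ∧ ∀ y, ∀ j ∉ I, σ y j = 0 := by
  have hs : LinearMap.range (π.comp (coordSubspace I).subtype) = ⊤ := by
    rw [eq_top_iff, ← hI2, Submodule.span_le]
    rintro _ ⟨j, hj, rfl⟩
    refine ⟨⟨Pi.single j 1, ?_⟩, hπ j⟩
    intro k hk
    have : k ≠ j := fun h => hk (h ▸ hj)
    simp [this]
  obtain ⟨g, hg⟩ := LinearMap.exists_rightInverse_of_surjective _ hs
  refine ⟨(coordSubspace I).subtype.comp g, fun y => ?_, fun y j hj => (g y).2 j hj⟩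
  exact LinearMap.congr_fun hg y

lemma aux_N {n d : ℕ} (π : (Fin d → ℝ) →ₗ[ℝ] (Fin n → ℝ)) (Q : AddSubgroup (Fin n → ℝ))
    (hmap : intLattice d ≤ Q.comap π.toAddMonoidHom) (θ : Fin d → ℝ) :
    torusMk d θ ∈ NGroup π Q hmap ↔ π θ ∈ Q := by
  unfold NGroup torusMk
  rw [AddMonoidHom.mem_ker]
  exact QuotientAddGroup.eq_zero_iff (N := Q) (π θ)

lemma aux_sub {d : ℕ} (I : Set (Fin d)) [DecidablePred (· ∈ I)] (θ : Fin d → ℝ)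
    (h : ∀ j ∉ I, ∃ m : ℤ, θ j = m) : torusMk d θ ∈ subTorus I := by
  refine ⟨I.piecewise θ 0, ?_, ?_⟩
  · intro j hj
    simp [hj]
  · refine (QuotientAddGroup.eq (s := intLattice d)).2 ?_
    intro j
    by_cases hj : j ∈ I
    · exact ⟨0, by simp [hj]⟩
    · obtain ⟨m, hm⟩ := h j hj
      exact ⟨m, by simp [hj, hm]⟩

lemma aux_norm (t : ℝ) : ‖Complex.exp (((2 * Real.pi * t : ℝ) : ℂ) * Complex.I)‖ = 1 :=
  Complex.norm_exp_ofReal_mul_I _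

lemma aux_exp_int {s t : ℝ}
    (h : Complex.exp (((2 * Real.pi * s : ℝ) : ℂ) * Complex.I) =
      Complex.exp (((2 * Real.pi * t : ℝ) : ℂ) * Complex.I)) : ∃ m : ℤ, s - t = m := by
  obtain ⟨m, hm⟩ := Complex.exp_eq_exp_iff_exists_int.1 h
  refine ⟨m, ?_⟩
  have h2 : ((2 * Real.pi * s : ℝ) : ℂ) = ((2 * Real.pi * t + m * (2 * Real.pi) : ℝ) : ℂ) := by
    apply mul_right_cancel₀ Complex.I_ne_zero
    rw [hm]
    push_cast
    ring
  have h3 := Complex.ofReal_injective h2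
  have h4 : (2 * Real.pi) * (s - t) = (2 * Real.pi) * m := by linarith
  exact mul_left_cancel₀ (by positivity) h4

lemma aux_rotate_add {d : ℕ} (s t : Fin d → ℝ) (z : Fin d → ℂ) :
    rotate (s + t) z = rotate s (rotate t z) := by
  ext j
  simp only [rotate, Pi.add_apply]
  rw [← mul_assoc, ← Complex.exp_add]
  congr 2
  push_cast
  ring

lemma aux_rotate_zero {d : ℕ} (z : Fin d → ℂ) : rotate 0 z = z := by
  ext j
  simp [rotate]

/-- The value of `μ_u` on the `X_j`, when `u` has the same moduli as `z ∈ Z` on `I`. -/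
lemma aux_mu {n d : ℕ} (X : Fin d → (Fin n → ℝ)) (lam : Fin d → ℝ)
    (π : (Fin d → ℝ) →ₗ[ℝ] (Fin n → ℝ)) (hπ : ∀ j, π (Pi.single j 1) = X j)
    (I : Set (Fin d)) (hI2 : Submodule.span ℝ (X '' I) = ⊤)
    (μ : Fin n → ℝ) (z : Fin d → ℂ) (hz : z ∈ ZSet π lam)
    (hμ : ∀ h ∈ I, pairR μ (X h) = ‖z h‖ ^ 2 + lam h) (j : Fin d) :
    pairR μ (X j) = ‖z j‖ ^ 2 + lam j := by
  obtain ⟨σ, hσ, hσ0⟩ := aux_section X π hπ I hI2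
  have h1 : pairR μ (X j) = pairR (UpsilonV lam z) (σ (X j)) := by
    conv_lhs => rw [← hσ (X j), aux_pair X π hπ]
    unfold pairR
    refine Finset.sum_congr rfl fun k _ => ?_
    by_cases hk : k ∈ I
    · rw [show piStar X μ k = UpsilonV lam z k from hμ k hk]
    · rw [hσ0 _ k hk]; simp
  have h2 := hz (Pi.single j 1 - σ (X j)) (by simp [hσ, hπ])
  have h3 : pairR (UpsilonV lam z) (Pi.single j 1 - σ (X j)) =
      UpsilonV lam z j - pairR (UpsilonV lam z) (σ (X j)) := by
    simp [pairR, mul_sub, Finset.sum_sub_distrib, Pi.single_apply]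
  rw [h1]
  change _ = UpsilonV lam z j
  linarith

/-- Slice theorem: with `{X_j : j ∈ I}` a basis of `ℝ^n`, `μ_u` the unique functional with
`⟨μ_u, X_h⟩ = |u_h|² + λ_h` for `h ∈ I`, `Ũ_I = {u ∈ ℂ^I : ⟨μ_u, X_j⟩ − λ_j > 0 for j ∉ I}`
and `φ̃_I(u)` the slice map (equal to `u` on `I` and to `√(⟨μ_u, X_j⟩ − λ_j)` outside `I`),
`φ̃_I(Ũ_I) ⊆ Z`, and for every `Γ_I`-invariant relatively closed subset `C ⊆ Ũ_I` the
saturation `N·φ̃_I(C)` is closed in `Û_I = Z ∩ {z : z_j ≠ 0 for j ∉ I}`. -/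
theorem stmt19 {n d : ℕ} (hn : 1 ≤ n) (hd : n ≤ d)
    (X : Fin d → (Fin n → ℝ)) (hX : Submodule.span ℝ (Set.range X) = ⊤)
    (lam : Fin d → ℝ)
    (π : (Fin d → ℝ) →ₗ[ℝ] (Fin n → ℝ)) (hπ : ∀ j, π (Pi.single j 1) = X j)
    (Q : AddSubgroup (Fin n → ℝ)) (hQ : IsQuasilattice Q) (hXQ : ∀ j, X j ∈ Q)
    (hmap : intLattice d ≤ Q.comap π.toAddMonoidHom)
    (I : Set (Fin d)) [DecidablePred (· ∈ I)]
    (hI1 : LinearIndependent ℝ (fun j : I => X j))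
    (hI2 : Submodule.span ℝ (X '' I) = ⊤)
    (Mu : (Fin d → ℂ) → (Fin n → ℝ))
    (hMu : ∀ u : Fin d → ℂ, ∀ h ∈ I, pairR (Mu u) (X h) = ‖u h‖ ^ 2 + lam h)
    (C : Set (Fin d → ℂ))
    (hCsub : C ⊆ {u | (∀ j ∉ I, u j = 0) ∧ ∀ j ∉ I, 0 < pairR (Mu u) (X j) - lam j})
    (hCclosed : IsClosed
      ((fun p : ↥{u : Fin d → ℂ | (∀ j ∉ I, u j = 0) ∧
          ∀ j ∉ I, 0 < pairR (Mu u) (X j) - lam j} => (p : Fin d → ℂ)) ⁻¹' C))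
    (hCinv : ∀ θ : Fin d → ℝ,
      torusMk d θ ∈ NGroup π Q hmap ⊓ subTorus I → ∀ u ∈ C, rotate θ u ∈ C) :
    (∀ u : Fin d → ℂ, (∀ j ∉ I, u j = 0) → (∀ j ∉ I, 0 < pairR (Mu u) (X j) - lam j) →
      I.piecewise u (fun j => (Real.sqrt (pairR (Mu u) (X j) - lam j) : ℂ)) ∈ ZSet π lam) ∧
    IsClosed
      ((fun p : ↥{z : Fin d → ℂ | z ∈ ZSet π lam ∧ ∀ j ∉ I, z j ≠ 0} => (p : Fin d → ℂ)) ⁻¹'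
        {z | ∃ θ : Fin d → ℝ, torusMk d θ ∈ NGroup π Q hmap ∧ ∃ u ∈ C,
          z = rotate θ
            (I.piecewise u (fun j => (Real.sqrt (pairR (Mu u) (X j) - lam j) : ℂ)))}) := by
  have hpart1 : ∀ u : Fin d → ℂ, (∀ j ∉ I, 0 < pairR (Mu u) (X j) - lam j) →
      I.piecewise u (fun j => (Real.sqrt (pairR (Mu u) (X j) - lam j) : ℂ)) ∈ ZSet π lam := by
    intro u hu x hx
    have hU : UpsilonV lam
        (I.piecewise u (fun j => (Real.sqrt (pairR (Mu u) (X j) - lam j) : ℂ))) =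
        piStar X (Mu u) := by
      ext j
      by_cases hj : j ∈ I
      · simp [UpsilonV, piStar, hj, hMu u j hj]
      · simp [UpsilonV, piStar, hj, Real.sq_sqrt (hu j hj).le]
    rw [hU, ← aux_pair X π hπ, LinearMap.mem_ker.1 hx]
    simp [pairR]
  refine ⟨fun u _ hu => hpart1 u hu, ?_⟩
  set S : Set (Fin d → ℂ) := {z | ∃ θ : Fin d → ℝ, torusMk d θ ∈ NGroup π Q hmap ∧ ∃ u ∈ C,
          z = rotate θ
            (I.piecewise u (fun j => (Real.sqrt (pairR (Mu u) (X j) - lam j) : ℂ)))} with hS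
  -- the slice coordinate
  have key : ∀ z : Fin d → ℂ, z ∈ ZSet π lam → (∀ j ∉ I, z j ≠ 0) → ∀ θ : Fin d → ℝ,
      π θ = 0 →
      (∀ j ∉ I, (‖z j‖ : ℂ) * Complex.exp (((2 * Real.pi * θ j : ℝ) : ℂ) * Complex.I) = z j) →
      ((∀ j ∉ I, I.piecewise (rotate (-θ) z) 0 j = 0) ∧
        ∀ j ∉ I, 0 < pairR (Mu (I.piecewise (rotate (-θ) z) 0)) (X j) - lam j) ∧
      (z ∈ S ↔ I.piecewise (rotate (-θ) z) 0 ∈ C) := by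
    intro z hz hz0 θ hθ harg
    set u : Fin d → ℂ := I.piecewise (rotate (-θ) z) 0 with hu
    have hmu : ∀ j, pairR (Mu u) (X j) = ‖z j‖ ^ 2 + lam j := by
      apply aux_mu X lam π hπ I hI2 (Mu u) z hz
      intro h hh
      rw [hMu u h hh]
      simp only [hu, hh, Set.piecewise_eq_of_mem, rotate, norm_mul, aux_norm, one_mul]
    refine ⟨⟨fun j hj => by simp [hu, hj], fun j hj => ?_⟩, ?_, ?_⟩
    · rw [hmu j]
      have := norm_pos_iff.2 (hz0 j hj)
      simp only [add_sub_cancel_right]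
      positivity
    · rintro ⟨θ', hθ', u', hu', hzu⟩
      have hC' := hCsub hu'
      have hint : ∀ j ∉ I, ∃ m : ℤ, (θ' - θ) j = m := by
        intro j hj
        have h1 : z j = Complex.exp (((2 * Real.pi * θ' j : ℝ) : ℂ) * Complex.I) *
            (Real.sqrt (pairR (Mu u') (X j) - lam j) : ℂ) := by
          rw [hzu]; simp [rotate, hj]
        have h2 : ‖z j‖ = Real.sqrt (pairR (Mu u') (X j) - lam j) := by
          rw [h1, norm_mul, aux_norm, one_mul, Complex.norm_real, Real.norm_eq_abs,
            abs_of_nonneg (Real.sqrt_nonneg _)]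
        have h3 := harg j hj
        rw [← h2] at h1
        replace h3 := h3.trans h1
        rw [mul_comm] at h3
        have h4 : (‖z j‖ : ℂ) ≠ 0 := by simpa using hz0 j hj
        exact aux_exp_int (mul_right_cancel₀ h4 h3).symm
      have hmem := hCinv (θ' - θ) ⟨?_, aux_sub I _ hint⟩ u' hu'
      · convert hmem using 1
        ext j
        by_cases hj : j ∈ I
        · simp only [hu, hj, Set.piecewise_eq_of_mem]
          rw [hzu, ← aux_rotate_add, neg_add_eq_sub]
          simp [rotate, hj]
        · simp [hu, hj, rotate, hC'.1 j hj]
      · change torusMk d (θ' - θ) ∈ NGroup π Q hmap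
        rw [aux_N] at hθ' ⊢
        rwa [map_sub, hθ, sub_zero]
    · intro huC
      refine ⟨θ, ?_, u, huC, ?_⟩
      · rw [aux_N, hθ]; exact Q.zero_mem
      · ext j
        by_cases hj : j ∈ I
        · have : rotate θ (rotate (-θ) z) = z := by
            rw [← aux_rotate_add, add_neg_cancel, aux_rotate_zero]
          conv_lhs => rw [← this]
          simp [rotate, hj, hu]
        · simp only [rotate, hj, Set.piecewise_eq_of_notMem, not_false_eq_true]
          rw [hmu j, add_sub_cancel_right, Real.sqrt_sq (norm_nonneg _), mul_comm]
          exact (harg j hj).symm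
  obtain ⟨σ, hσ, hσ0⟩ := aux_section X π hπ I hI2
  obtain ⟨K, hK, hKC⟩ := isClosed_induced_iff.1 hCclosed
  have hKC' : ∀ u : Fin d → ℂ, ((∀ j ∉ I, u j = 0) ∧ ∀ j ∉ I, 0 < pairR (Mu u) (X j) - lam j) →
      (u ∈ K ↔ u ∈ C) := fun u hu => Set.ext_iff.1 hKC ⟨u, hu⟩
  rw [← closure_subset_iff_isClosed]
  rintro ⟨z₀, hz₀⟩ hcl
  -- a continuous local choice of arguments near `z₀`
  let τ : (Fin d → ℂ) → (Fin d → ℝ) := fun z j =>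
    if j ∈ I then 0 else ((z₀ j).arg + (z j / z₀ j).arg) / (2 * Real.pi)
  have hτc : ContinuousAt τ z₀ := by
    rw [continuousAt_pi]
    intro j
    by_cases hj : j ∈ I
    · simp only [τ, hj, if_true]
      exact continuousAt_const
    · simp only [τ, hj, if_false]
      have h1 : ContinuousAt (fun z : Fin d → ℂ => z j / z₀ j) z₀ :=
        ((continuous_apply j).div_const _).continuousAt
      have h2 : ContinuousAt Complex.arg ((fun z : Fin d → ℂ => z j / z₀ j) z₀) := by
        apply Complex.continuousAt_arg
        simp [div_self (hz₀.2 j hj)]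
      exact (continuousAt_const.add (ContinuousAt.comp (g := Complex.arg) (f := fun z : Fin d → ℂ => z j / z₀ j) h2 h1)).div_const _
  let Θ : (Fin d → ℂ) → (Fin d → ℝ) := fun z => τ z - σ (π (τ z))
  have hΘc : ContinuousAt Θ z₀ := by
    refine hτc.sub ?_
    have : Continuous (σ.comp π) := LinearMap.continuous_of_finiteDimensional _
    exact this.continuousAt.comp hτc
  have hΘ0 : ∀ z, π (Θ z) = 0 := fun z => by simp [Θ, hσ]
  have hΘarg : ∀ z : Fin d → ℂ, (∀ j ∉ I, z j ≠ 0) → ∀ j ∉ I,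
      (‖z j‖ : ℂ) * Complex.exp (((2 * Real.pi * Θ z j : ℝ) : ℂ) * Complex.I) = z j := by
    intro z hz j hj
    have h1 : 2 * Real.pi * Θ z j = (z₀ j).arg + (z j / z₀ j).arg := by
      simp only [Θ, τ, Pi.sub_apply, hσ0 _ j hj, hj, if_false, sub_zero]
      field_simp
    have h0 := hz₀.2 j hj
    have hn0 : (‖z₀ j‖ : ℂ) ≠ 0 := by simpa using h0
    have ha := Complex.norm_mul_exp_arg_mul_I (z₀ j)
    have hb := Complex.norm_mul_exp_arg_mul_I (z j / z₀ j)
    rw [h1]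
    push_cast
    rw [add_mul, Complex.exp_add]
    rw [norm_div] at hb
    push_cast at hb
    calc _ = ((‖z₀ j‖ : ℂ) * Complex.exp ((z₀ j).arg * Complex.I)) *
          ((‖z j‖ : ℂ) / (‖z₀ j‖ : ℂ) * Complex.exp ((z j / z₀ j).arg * Complex.I)) := by
          field_simp
      _ = z j := by rw [ha, hb]; field_simp
  let F : (Fin d → ℂ) → (Fin d → ℂ) := fun z => I.piecewise (rotate (-(Θ z)) z) 0
  have hFc : ContinuousAt F z₀ := by
    rw [continuousAt_pi]
    intro j
    by_cases hj : j ∈ I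
    · simp only [F, hj, Set.piecewise_eq_of_mem, rotate, Pi.neg_apply]
      have h1 : ContinuousAt (fun z => Θ z j) z₀ := (continuousAt_pi.1 hΘc) j
      have h2 : Continuous (fun t : ℝ =>
          Complex.exp (((2 * Real.pi * -t : ℝ) : ℂ) * Complex.I)) := by fun_prop
      exact (h2.continuousAt.comp h1).mul (continuous_apply j).continuousAt
    · simp only [F, hj, Set.piecewise_eq_of_notMem, not_false_eq_true]
      exact continuousAt_const
  have hFS : ∀ z : Fin d → ℂ, z ∈ ZSet π lam → (∀ j ∉ I, z j ≠ 0) → (z ∈ S ↔ F z ∈ K) := by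
    intro z hz hz0
    obtain ⟨h1, h2⟩ := key z hz hz0 (Θ z) (hΘ0 z) (hΘarg z hz0)
    rw [h2, ← hKC' _ h1]
  refine (hFS z₀ hz₀.1 hz₀.2).2 ?_
  have hc : ContinuousAt (fun p : ↥{z : Fin d → ℂ | z ∈ ZSet π lam ∧ ∀ j ∉ I, z j ≠ 0} =>
      F (p : Fin d → ℂ)) ⟨z₀, hz₀⟩ :=
    ContinuousAt.comp (g := F) hFc continuous_subtype_val.continuousAt
  have := hc.continuousWithinAt.mem_closure (t := K) hcl
    (fun p hp => (hFS p p.2.1 p.2.2).1 hp)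
  rwa [hK.closure_eq] at this

end
end
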